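/- Let $A_\Gamma$ be a 3-free Artin group and let $a, b, c \in X$ be pairwise distinct generators with $m(a,b) > 3$, $m(b,c) > 3$, and $m(a,c) = 2$. Then each of the following is a blocking pair: $(babc,\; b^{-1})$, $(cb^{-1},\; a^{-1})$, $(bcb^{-1}a^{-1},\; b^{-1})$, and $(a^{-1}b^{-1},\; c^{-1})$. -/

import Mathlib

/-- The alternating product `x y x y ⋯` of length `n` in the free group, starting with `x`. -/
def altProd {X : Type*} : ℕ → X → X → FreeGroup X
  | 0, _, _ => 1
  | n + 1, x, y => FreeGroup.of x * altProd n y x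

/-- The Artin relations associated to a labelling `m : X → X → ℕ∞` (label `⊤` = no relation):
for each pair `x ≠ y` with finite label `k`, the relator `(xyx⋯)(yxy⋯)⁻¹` (both of length `k`). -/
def artinRels {X : Type*} (m : X → X → ℕ∞) : Set (FreeGroup X) :=
  { r | ∃ (x y : X) (k : ℕ), x ≠ y ∧ m x y = (k : ℕ∞) ∧
      r = altProd k x y * (altProd k y x)⁻¹ }

/-- The Artin group of the labelled graph encoded by `m`. -/
abbrev ArtinGroup {X : Type*} (m : X → X → ℕ∞) : Type _ := PresentedGroup (artinRels m)

/-- The standard generators of the Artin group. -/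
def artinGen {X : Type*} (m : X → X → ℕ∞) (x : X) : ArtinGroup m := PresentedGroup.of x

/-- The Artin monoid: the submonoid of the Artin group generated by the standard generators. -/
def artinMonoid {X : Type*} (m : X → X → ℕ∞) : Submonoid (ArtinGroup m) :=
  Submonoid.closure (Set.range (artinGen m))

/-- The monoid word metric on a group `G` relative to a submonoid `M`: `monoidDist M g h` is the
least `n` such that `g⁻¹ * h` is a product of `n` elements each lying in `M` or `M⁻¹`. -/
noncomputable def monoidDist {G : Type*} [Group G] (M : Submonoid G) (g h : G) : ℕ :=
  sInf { n : ℕ | ∃ l : List G, l.length = n ∧ (∀ a ∈ l, a ∈ M ∨ a⁻¹ ∈ M) ∧ g⁻¹ * h = l.prod }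

/-- A word over `X`: a list of letters `x^ε`, where `ε = true` denotes the positive letter `x`
and `ε = false` the negative letter `x⁻¹`. -/
abbrev Word (X : Type*) := List (X × Bool)

/-- The element of `G` represented by a word over `X`, given `f : X → G`. -/
def evalWord {X G : Type*} [Group G] (f : X → G) (w : Word X) : G :=
  (w.map (fun p => if p.2 then f p.1 else (f p.1)⁻¹)).prod

/-- A word is positive if all its letters are positive. -/
def IsPosWord {X : Type*} (w : Word X) : Prop := ∀ p ∈ w, p.2 = true

/-- A word is negative if all its letters are negative. -/
def IsNegWord {X : Type*} (w : Word X) : Prop := ∀ p ∈ w, p.2 = false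

/-- A word is geodesic if no strictly shorter word represents the same element of `G`. -/
def IsGeodesic {X G : Type*} [Group G] (f : X → G) (w : Word X) : Prop :=
  ∀ v : Word X, evalWord f v = evalWord f w → w.length ≤ v.length

/-- `(u, x)` is a blocking pair if for every word `w` such that `w ++ u` is geodesic,
the word `w ++ u ++ [x]` is also geodesic. -/
def BlockingPair {X G : Type*} [Group G] (f : X → G) (u : Word X) (x : X × Bool) : Prop :=
  ∀ w : Word X, IsGeodesic f (w ++ u) → IsGeodesic f (w ++ u ++ [x])

/-- An alternating blocking sequence `(α n)` (indexed from `n = 1`; the value `α 0` is ignored):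
each `α n` is nonempty, positive for odd `n` and negative for even `n`, and every letter `x`
of `α n` is immediately preceded, within `α (n-1) ++ α n` (with `α 0` read as the empty word),
by a subword `u` such that `(u, x)` is a blocking pair. -/
def IsAltBlockingSeq {X G : Type*} [Group G] (f : X → G) (α : ℕ → Word X) : Prop :=
  (∀ n, 1 ≤ n → α n ≠ []) ∧
  (∀ n, 1 ≤ n → Odd n → IsPosWord (α n)) ∧
  (∀ n, 1 ≤ n → Even n → IsNegWord (α n)) ∧
  (∀ n, 1 ≤ n → ∀ p x s, α n = p ++ x :: s →
    ∃ u : Word X, u <:+ ((if n = 1 then ([] : Word X) else α (n - 1)) ++ p) ∧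
      BlockingPair f u x)

/-- `u` is the longest positive (`ε = true`) resp. negative (`ε = false`) proper suffix of `w`. -/
def IsLongestSignedProperSuffix {X : Type*} (ε : Bool) (w u : Word X) : Prop :=
  u <:+ w ∧ u ≠ w ∧ (∀ p ∈ u, p.2 = ε) ∧
    ∀ v : Word X, v <:+ w → v ≠ w → (∀ p ∈ v, p.2 = ε) → v.length ≤ u.length

/-- Preserved positive (`ε = true`) resp. negative (`ε = false`) suffixes: whenever `w` is a
geodesic word ending in a letter of sign `ε`, `u` is the longest proper suffix of `w` of sign `ε`,
and `a` is a generator, the element represented by `a^ε · w` admits a geodesic representative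
having `u` as a suffix. -/
def PreservedSignSuffixes {X G : Type*} [Group G] (ε : Bool) (f : X → G) : Prop :=
  ∀ (w : Word X) (y : X), IsGeodesic f w → w.getLast? = some (y, ε) →
    ∀ u : Word X, IsLongestSignedProperSuffix ε w u →
    ∀ a : X, ∃ w' : Word X, IsGeodesic f w' ∧
      evalWord f w' = evalWord f ((a, ε) :: w) ∧ u <:+ w'

/-- Preserved signed suffixes: both preserved positive and preserved negative suffixes. -/
def PreservedSignedSuffixes {X G : Type*} [Group G] (f : X → G) : Prop :=
  PreservedSignSuffixes true f ∧ PreservedSignSuffixes false f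

namespace ArtinBlocking

section Words

variable {X G : Type*} [Group G]

/-- The element represented by a single signed letter. -/
def letterVal (f : X → G) (p : X × Bool) : G := if p.2 then f p.1 else (f p.1)⁻¹

/-- The formal inverse of a signed letter. -/
def flipSign (p : X × Bool) : X × Bool := (p.1, !p.2)

@[simp] theorem flipSign_flipSign (p : X × Bool) : flipSign (flipSign p) = p := by
  simp [flipSign]

@[simp] theorem flipSign_fst (p : X × Bool) : (flipSign p).1 = p.1 := rfl

@[simp] theorem letterVal_flipSign (f : X → G) (p : X × Bool) :
    letterVal f (flipSign p) = (letterVal f p)⁻¹ := by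
  rcases p with ⟨x, _ | _⟩ <;> simp [letterVal, flipSign]

@[simp] theorem evalWord_nil (f : X → G) : evalWord f [] = 1 := rfl

@[simp] theorem evalWord_cons (f : X → G) (p : X × Bool) (w : Word X) :
    evalWord f (p :: w) = letterVal f p * evalWord f w := by
  simp [evalWord, letterVal]

@[simp] theorem evalWord_append (f : X → G) (u w : Word X) :
    evalWord f (u ++ w) = evalWord f u * evalWord f w := by
  simp [evalWord]

/-- The formal inverse of a word. -/
def invWord (w : Word X) : Word X := (w.map flipSign).reverse

@[simp] theorem invWord_length (w : Word X) : (invWord w).length = w.length := by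
  simp [invWord]

@[simp] theorem evalWord_invWord (f : X → G) (w : Word X) :
    evalWord f (invWord w) = (evalWord f w)⁻¹ := by
  induction w with
  | nil => simp [invWord]
  | cons p w ih =>
    have : invWord (p :: w) = invWord w ++ [flipSign p] := by simp [invWord]
    rw [this, evalWord_append, ih]
    simp

@[simp] theorem invWord_invWord (w : Word X) : invWord (invWord w) = w := by
  simp [invWord, List.map_reverse, Function.comp_def]

@[simp] theorem invWord_append (u w : Word X) : invWord (u ++ w) = invWord w ++ invWord u := by
  simp [invWord]

theorem isGeodesic_invWord {f : X → G} {w : Word X} (h : IsGeodesic f w) :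
    IsGeodesic f (invWord w) := by
  intro v hv
  have := h (invWord v) (by rw [evalWord_invWord, hv, evalWord_invWord, inv_inv])
  simpa using this

theorem IsGeodesic.tail {f : X → G} {p : X × Bool} {w : Word X} (h : IsGeodesic f (p :: w)) :
    IsGeodesic f w := by
  intro v hv
  have := h (p :: v) (by simp [hv])
  simpa using this

theorem IsGeodesic.of_eq {f : X → G} {u w : Word X} (h : IsGeodesic f u)
    (he : evalWord f w = evalWord f u) (hl : w.length ≤ u.length) : IsGeodesic f w := by
  intro v hv
  exact hl.trans (h v (hv.trans he))

theorem IsGeodesic.length_eq {f : X → G} {u w : Word X} (h : IsGeodesic f u)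
    (hw : IsGeodesic f w) (he : evalWord f u = evalWord f w) : u.length = w.length :=
  le_antisymm (h _ he.symm) (hw _ he)

end Words

section DihedralStates

/-- `b` flipped `n` times. -/
def tog (b : Bool) (n : ℕ) : Bool := xor b n.bodd

@[simp] theorem tog_zero (b : Bool) : tog b 0 = b := by simp [tog]

theorem tog_succ (b : Bool) (n : ℕ) : tog b (n + 1) = !(tog b n) := by
  cases b <;> simp [tog, Nat.bodd_succ]

theorem tog_not (b : Bool) (n : ℕ) : tog (!b) n = !(tog b n) := by
  cases b <;> simp [tog]

theorem tog_tog (b : Bool) (i j : ℕ) : tog (tog b i) j = tog b (i + j) := by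
  simp [tog, Nat.bodd_add]

theorem tog_add_two (b : Bool) (n : ℕ) : tog b (n + 2) = tog b n := by
  simp [tog_succ]

/-- A combinatorial normal form for an element of a dihedral Artin group: the letter extending
the leading alternating run, the lengths of the leading runs, and the length (in `ℤ`) of the final
alternating run. -/
abbrev RunState := Bool × List ℕ × ℤ

/-- Left multiplication of a normal form by a generator. -/
def pushPos (M : ℕ) (b : Bool) : RunState → RunState
  | (e, [], N) => if b = e then (!e, [], N + 1) else (e, [1], N)
  | (e, r :: R, N) =>
    if b = e then (if r + 1 < M then (!e, (r + 1) :: R, N) else (e, R, N + M))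
    else (e, 1 :: r :: R, N)

/-- Left multiplication of a normal form by the inverse of a generator. -/
def pushNeg (M : ℕ) (b : Bool) : RunState → RunState
  | (e, [], N) => if b = e then (e, [M - 1], N - M) else (b, [], N - 1)
  | (e, r :: R, N) =>
    if b = e then (e, (M - 1) :: r :: R, N - M)
    else if r = 1 then (e, R, N) else (b, (r - 1) :: R, N)

/-- All leading runs are nonempty and shorter than the Garside element. -/
def ValidState (M : ℕ) (s : RunState) : Prop := ∀ r ∈ s.2.1, 1 ≤ r ∧ r < M

variable {M : ℕ}

theorem ValidState.pushPos (hM : 2 ≤ M) {s : RunState} (hs : ValidState M s) (b : Bool) :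
    ValidState M (pushPos M b s) := by
  obtain ⟨e, R, N⟩ := s
  cases R <;> simp only [ArtinBlocking.pushPos] <;> split_ifs <;>
    simp_all [ValidState] <;> omega

theorem ValidState.pushNeg (hM : 2 ≤ M) {s : RunState} (hs : ValidState M s) (b : Bool) :
    ValidState M (pushNeg M b s) := by
  obtain ⟨e, R, N⟩ := s
  cases R <;> simp only [ArtinBlocking.pushNeg] <;> split_ifs <;>
    simp_all [ValidState] <;> omega

theorem pushNeg_pushPos {s : RunState} (hM : 2 ≤ M) (hs : ValidState M s) (b : Bool) :
    pushNeg M b (pushPos M b s) = s := by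
  obtain ⟨e, _ | ⟨r, R⟩, N⟩ := s
  · by_cases h : b = e <;> simp [pushPos, pushNeg, h]
  · have h1 := hs r (by simp)
    by_cases h : b = e
    · by_cases h2 : r + 1 < M
      · simp [pushPos, pushNeg, h, h2]
        omega
      · cases R <;> simp [pushPos, pushNeg, h, h2] <;> omega
    · simp [pushPos, pushNeg, h]

theorem pushPos_pushNeg {s : RunState} (hM : 2 ≤ M) (hs : ValidState M s) (b : Bool) :
    pushPos M b (pushNeg M b s) = s := by
  obtain ⟨e, _ | ⟨r, R⟩, N⟩ := s
  · by_cases h : b = e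
    · simp [pushPos, pushNeg, h]; omega
    · have : (!b) = e := by revert h; cases b <;> cases e <;> simp
      simp [pushPos, pushNeg, h, this]
  · have h1 := hs r (by simp)
    by_cases h : b = e
    · simp [pushPos, pushNeg, h]; omega
    · have hbe : (!b) = e := by revert h; cases b <;> cases e <;> simp
      by_cases h2 : r = 1
      · subst h2
        cases R <;> simp [pushPos, pushNeg, h]
      · have : r - 1 + 1 = r := by omega
        simp [pushPos, pushNeg, h, h2, this, hbe, h1.2]

/-- Left multiplication by an alternating word of length `j` whose last letter is `c`. -/
def pushAlt (M : ℕ) : ℕ → Bool → RunState → RunState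
  | 0, _, s => s
  | j + 1, c, s => pushAlt M j (!c) (pushPos M c s)

theorem pushAlt_add (i j : ℕ) (c : Bool) (s : RunState) :
    pushAlt M (i + j) c s = pushAlt M j (tog c i) (pushAlt M i c s) := by
  induction i generalizing c s with
  | zero => simp [pushAlt]
  | succ i ih =>
    rw [Nat.succ_add_eq_add_succ, Nat.add_succ, pushAlt, ih, pushAlt, tog_succ, tog_not]

theorem pushAlt_extend (j : ℕ) (e : Bool) (r : ℕ) (R : List ℕ) (N : ℤ) (h : r + j < M) :
    pushAlt M j e (e, r :: R, N) = (tog e j, (r + j) :: R, N) := by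
  induction j generalizing e r with
  | zero => simp [pushAlt]
  | succ j ih =>
    have : r + 1 < M := by omega
    simp only [pushAlt, pushPos, this, if_true]
    rw [ih _ _ (by omega)]
    simp [tog_succ, tog_not]; omega

theorem pushAlt_extend_last (j : ℕ) (e : Bool) (N : ℤ) :
    pushAlt M j e (e, [], N) = (tog e j, [], N + j) := by
  induction j generalizing e N with
  | zero => simp [pushAlt]
  | succ j ih =>
    simp only [pushAlt, pushPos, if_true]
    rw [ih]
    simp [tog_succ, tog_not]; omega

/-- Left multiplication by the Garside element. -/
theorem pushAlt_self (hM : 2 ≤ M) (c : Bool) (s : RunState) (hs : ValidState M s) :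
    pushAlt M M c s = (tog s.1 M, s.2.1, s.2.2 + M) := by
  obtain ⟨e, R, N⟩ := s
  obtain ⟨m, rfl⟩ : ∃ m, M = m + 2 := ⟨M - 2, by omega⟩
  by_cases h : c = e
  · subst h
    rcases R with _ | ⟨r, R⟩
    · rw [pushAlt_extend_last]
    · have h1 := hs r (by simp)
      obtain ⟨i, hi⟩ : ∃ i, m + 1 = r + i := ⟨m + 1 - r, by omega⟩
      obtain ⟨r, rfl⟩ : ∃ q, r = q + 1 := ⟨r - 1, by omega⟩
      have e1 : pushAlt (m + 2) (m + 2) c (c, (r + 1) :: R, N)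
          = pushAlt (m + 2) (i + (1 + (1 + r))) c (c, (r + 1) :: R, N) := by
        congr 1; omega
      rw [e1, pushAlt_add, pushAlt_extend _ _ _ _ _ (by omega), pushAlt_add]
      have e2 : ¬ (r + 1 + i + 1 < m + 2) := by omega
      simp only [pushAlt, pushPos, e2, if_true, if_false]
      rw [pushAlt_add]
      have e3 : pushPos (m + 2) (tog (tog c i) 1) (tog c i, R, N + (m + 2 : ℕ))
          = (tog c i, 1 :: R, N + (m + 2 : ℕ)) := by
        cases R <;> simp [pushPos, tog_succ]
      simp only [pushAlt, e3]
      have e4 : tog (tog (tog c i) 1) 1 = tog c i := by simp [tog_succ]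
      rw [e4, pushAlt_extend _ _ _ _ _ (by omega), tog_tog]
      have e5 : m = i + r := by omega
      simp only [tog_add_two, ← e5, Nat.add_comm 1 r]
  · have hc : c = !e := by revert h; cases c <;> cases e <;> simp
    have e3 : pushPos (m + 2) c (e, R, N) = (e, 1 :: R, N) := by
      cases R <;> simp [pushPos, hc]
    have e1 : pushAlt (m + 2) (m + 2) c (e, R, N)
        = pushAlt (m + 2) (m + 1) e (e, 1 :: R, N) := by
      rw [pushAlt, e3, hc]; simp
    rw [e1, pushAlt_add, pushAlt_extend _ _ _ _ _ (by omega)]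
    have e2 : ¬ (1 + m + 1 < m + 2) := by omega
    simp [pushAlt, pushPos, e2, tog_add_two]

end DihedralStates

section DihedralGroup

/-- The dihedral Artin group of label `M`. -/
abbrev Dih (M : ℕ) : Type := ArtinGroup (fun _ _ : Bool => (M : ℕ∞))

/-- The value of a word in the dihedral Artin group. -/
abbrev dev (M : ℕ) (s : Word Bool) : Dih M := evalWord (artinGen fun _ _ : Bool => (M : ℕ∞)) s

/-- A generator of the dihedral Artin group. -/
abbrev dgen (M : ℕ) (b : Bool) : Dih M := artinGen (fun _ _ : Bool => (M : ℕ∞)) b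

/-- Geodesic words in the dihedral Artin group. -/
abbrev DGeo (M : ℕ) (s : Word Bool) : Prop :=
  IsGeodesic (artinGen fun _ _ : Bool => (M : ℕ∞)) s

/-- An alternating product of two elements of a group. -/
def altMul {G : Type*} [Group G] (f : Bool → G) : ℕ → Bool → G
  | 0, _ => 1
  | n + 1, b => f b * altMul f n (!b)

theorem lift_altProd {X G : Type*} [Group G] (f : X → G) (n : ℕ) (x y : X) :
    FreeGroup.lift f (altProd n x y) = altMul (fun b => if b then f x else f y) n true := by
  have key : ∀ n (x y : X), FreeGroup.lift f (altProd n x y)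
      = altMul (fun b => if b then f x else f y) n true ∧
      FreeGroup.lift f (altProd n y x) = altMul (fun b => if b then f x else f y) n false := by
    intro n
    induction n with
    | zero => simp [altProd, altMul]
    | succ n ih =>
      intro x y
      simp [altProd, altMul, (ih x y).1, (ih x y).2]
  exact (key n x y).1

theorem lift_artinRels {X G : Type*} [Group G] {m : X → X → ℕ∞} (f : X → G)
    (h : ∀ x y (k : ℕ), x ≠ y → m x y = k →
      altMul (fun b => if b then f x else f y) k true =
        altMul (fun b => if b then f x else f y) k false) :
    ∀ r ∈ artinRels m, FreeGroup.lift f r = 1 := by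
  rintro r ⟨x, y, k, hxy, hk, rfl⟩
  have e : altMul (fun b => if b then f y else f x) k true
      = altMul (fun b => if b then f x else f y) k false := by
    have : ∀ n b, altMul (fun b => if b then f y else f x) n b
        = altMul (fun b => if b then f x else f y) n (!b) := by
      intro n
      induction n with
      | zero => simp [altMul]
      | succ n ih => intro b; cases b <;> simp [altMul, ih]
    simpa using this k true
  rw [map_mul, map_inv, lift_altProd, lift_altProd, e, h x y k hxy hk, mul_inv_cancel]

theorem altMul_artinGen {X : Type*} {m : X → X → ℕ∞} {x y : X} {k : ℕ} (hxy : x ≠ y)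
    (hk : m x y = k) :
    altMul (fun b => if b then artinGen m x else artinGen m y) k true =
      altMul (fun b => if b then artinGen m x else artinGen m y) k false := by
  have h : PresentedGroup.mk (artinRels m) (altProd k x y * (altProd k y x)⁻¹) = 1 :=
    PresentedGroup.one_of_mem ⟨x, y, k, hxy, hk, rfl⟩
  have e : PresentedGroup.mk (artinRels m) = FreeGroup.lift (artinGen m) := by
    ext x; simp [artinGen, PresentedGroup.of]
  rw [e, map_mul, map_inv, mul_inv_eq_one, lift_altProd, lift_altProd] at h
  rw [h]
  have : ∀ n b, altMul (fun b => if b then artinGen m y else artinGen m x) n b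
      = altMul (fun b => if b then artinGen m x else artinGen m y) n (!b) := by
    intro n
    induction n with
    | zero => simp [altMul]
    | succ n ih => intro b; cases b <;> simp [altMul, ih]
  simpa using this k true

theorem altMul_add {G : Type*} [Group G] (f : Bool → G) (i j : ℕ) (b : Bool) :
    altMul f (i + j) b = altMul f i b * altMul f j (tog b i) := by
  induction i generalizing b with
  | zero => simp [altMul]
  | succ i ih =>
    rw [Nat.succ_add_eq_add_succ, Nat.add_succ, altMul, ih, altMul, tog_succ, tog_not, mul_assoc]

/-- The homomorphism from a dihedral Artin group given by two elements satisfying its relation. -/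
def dihLift {G : Type*} [Group G] {M : ℕ} (f : Bool → G)
    (h : altMul f M true = altMul f M false) : Dih M →* G :=
  PresentedGroup.toGroup (f := f) (rels := artinRels fun _ _ : Bool => (M : ℕ∞)) <|
    lift_artinRels f (by
      intro x y k hxy hk
      have hk' : M = k := by exact_mod_cast hk
      subst hk'
      have : ∀ n b, altMul (fun b => if b then f x else f y) n b
          = altMul f n (if b then x else y) := by
        intro n
        induction n with
        | zero => simp [altMul]
        | succ n ih =>
          intro b
          have : x = !y := by revert hxy; cases x <;> cases y <;> simp
          subst this
          cases b <;> simp [altMul, ih]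
      rw [this, this]
      have : x = !y := by revert hxy; cases x <;> cases y <;> simp
      subst this
      cases y <;> simp [h])

@[simp] theorem dihLift_dgen {G : Type*} [Group G] {M : ℕ} (f : Bool → G)
    (h : altMul f M true = altMul f M false) (b : Bool) : dihLift f h (dgen M b) = f b :=
  PresentedGroup.toGroup.of _

theorem map_evalWord {X G H : Type*} [Group G] [Group H] (φ : G →* H) (f : X → G) (w : Word X) :
    φ (evalWord f w) = evalWord (fun x => φ (f x)) w := by
  induction w with
  | nil => simp
  | cons p w ih => rcases p with ⟨x, _ | _⟩ <;> simp [letterVal, ih]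

theorem dihLift_dev {G : Type*} [Group G] {M : ℕ} (f : Bool → G)
    (h : altMul f M true = altMul f M false) (s : Word Bool) :
    dihLift f h (dev M s) = evalWord f s := by
  rw [map_evalWord]; simp

theorem altMul_dgen (M : ℕ) (b : Bool) : altMul (dgen M) M b = altMul (dgen M) M true := by
  have h := altMul_artinGen (m := fun _ _ : Bool => (M : ℕ∞)) (x := true) (y := false) (k := M)
    (by simp) rfl
  have e : (fun b => if b then dgen M true else dgen M false) = dgen M := by
    funext b; cases b <;> rfl
  rw [e] at h
  cases b
  · exact h.symm
  · rfl

theorem evalWord_map {X Y G : Type*} [Group G] (f : Y → G) (g : X → Y) (w : Word X) :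
    evalWord f (w.map (Prod.map g id)) = evalWord (fun x => f (g x)) w := by
  induction w with
  | nil => simp
  | cons p w ih => rcases p with ⟨x, _ | _⟩ <;> simp [letterVal, ih]

/-- Interchange of the two letters. -/
def swapWord (s : Word Bool) : Word Bool := s.map (Prod.map not id)

@[simp] theorem swapWord_swapWord (s : Word Bool) : swapWord (swapWord s) = s := by
  simp [swapWord, Function.comp_def, Prod.map]

@[simp] theorem swapWord_length (s : Word Bool) : (swapWord s).length = s.length := by
  simp [swapWord]

theorem dev_swapWord {M : ℕ} {s t : Word Bool} (h : dev M s = dev M t) :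
    dev M (swapWord s) = dev M (swapWord t) := by
  have hf : altMul (fun b => dgen M (!b)) M true = altMul (fun b => dgen M (!b)) M false := by
    have : ∀ n b, altMul (fun b => dgen M (!b)) n b = altMul (dgen M) n (!b) := by
      intro n
      induction n with
      | zero => simp [altMul]
      | succ n ih => intro b; simp [altMul, ih]
    rw [this, this, altMul_dgen M (!true), altMul_dgen M (!false)]
  have := congrArg (dihLift _ hf) h
  rw [dihLift_dev, dihLift_dev] at this
  rwa [dev, dev, swapWord, swapWord, evalWord_map, evalWord_map]

theorem DGeo.swapWord {M : ℕ} {s : Word Bool} (h : DGeo M s) : DGeo M (swapWord s) := by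
  intro v hv
  have := h (ArtinBlocking.swapWord v) (by
    have := dev_swapWord hv
    rwa [swapWord_swapWord] at this)
  simpa using this

theorem dev_length_parity {M : ℕ} {s t : Word Bool} (h : dev M s = dev M t) :
    s.length % 2 = t.length % 2 := by
  have hf : altMul (fun _ : Bool => Multiplicative.ofAdd (1 : ZMod 2)) M true
      = altMul (fun _ : Bool => Multiplicative.ofAdd (1 : ZMod 2)) M false := by
    have : ∀ n b c, altMul (fun _ : Bool => Multiplicative.ofAdd (1 : ZMod 2)) n b
        = altMul (fun _ : Bool => Multiplicative.ofAdd (1 : ZMod 2)) n c := by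
      intro n
      induction n with
      | zero => simp [altMul]
      | succ n ih => intro b c; rw [altMul, altMul, ih (!b) (!c)]
    exact this _ _ _
  have key : ∀ s : Word Bool, evalWord (fun _ : Bool => Multiplicative.ofAdd (1 : ZMod 2)) s
      = Multiplicative.ofAdd (s.length : ZMod 2) := by
    intro s
    induction s with
    | nil => simp
    | cons p s ih =>
      have : (Multiplicative.ofAdd (1 : ZMod 2))⁻¹ = Multiplicative.ofAdd 1 := by decide
      rw [evalWord_cons, ih, letterVal, this, ite_self, ← ofAdd_add, List.length_cons,
        Nat.cast_add, Nat.cast_one, add_comm]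
  have := congrArg (dihLift _ hf) h
  rw [dihLift_dev, dihLift_dev, key, key] at this
  have := Multiplicative.ofAdd.injective this
  exact (ZMod.natCast_eq_natCast_iff' _ _ _).1 this

/-- Alternating products of integer length. -/
def altZ (M : ℕ) (N : ℤ) (b : Bool) : Dih M :=
  if Even N then (dgen M b * dgen M !b) ^ (N / 2)
  else (dgen M b * dgen M !b) ^ (N / 2) * dgen M b

variable {M : ℕ}

@[simp] theorem altZ_zero (b : Bool) : altZ M 0 b = 1 := by simp [altZ]

theorem altZ_add_one (N : ℤ) (b : Bool) : altZ M (N + 1) b = dgen M b * altZ M N (!b) := by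
  have hs : ∀ j : ℤ, dgen M b * (dgen M (!b) * dgen M b) ^ j
      = (dgen M b * dgen M (!b)) ^ j * dgen M b := by
    intro j
    have : SemiconjBy (dgen M b) (dgen M (!b) * dgen M b) (dgen M b * dgen M (!b)) := by
      simp [SemiconjBy, mul_assoc]
    exact this.zpow_right j
  rcases Int.even_or_odd' N with ⟨j, rfl | rfl⟩
  · have h1 : ¬ Even (2 * j + 1) := by simp
    have h2 : (2 * j + 1) / 2 = j := by omega
    have h3 : 2 * j / 2 = j := by omega
    simp [altZ, h2, hs]
  · have h2 : (2 * j + 1) / 2 = j := by omega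
    have h3 : (2 * j + 1 + 1) / 2 = j + 1 := by omega
    have h1 : Even (2 * j + 1 + 1) := by rw [Int.even_add_one]; simp
    have h4 : ¬ Even (2 * j + 1) := by simp
    simp only [altZ, h1, h4, h2, h3, if_true, if_false, Bool.not_not]
    rw [← mul_assoc, hs, zpow_add_one, mul_assoc]

theorem altZ_nat_add (n : ℕ) (N : ℤ) (b : Bool) :
    altZ M (n + N) b = altMul (dgen M) n b * altZ M N (tog b n) := by
  induction n generalizing b with
  | zero => simp [altMul]
  | succ n ih =>
    have : ((n + 1 : ℕ) : ℤ) + N = n + N + 1 := by push_cast; ring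
    rw [this, altZ_add_one, ih, altMul, tog_succ, tog_not, mul_assoc]

theorem altZ_length (N : ℤ) (b : Bool) :
    ∃ t : Word Bool, dev M t = altZ M N b ∧ t.length = N.natAbs := by
  have hpos : ∀ n : ℕ, ∀ b, ∃ t : Word Bool, dev M t = altZ M n b ∧ t.length = n := by
    intro n
    induction n with
    | zero => intro b; exact ⟨[], by simp⟩
    | succ n ih =>
      intro b
      obtain ⟨t, h1, h2⟩ := ih (!b)
      refine ⟨(b, true) :: t, ?_, by simp [h2]⟩
      push_cast
      rw [altZ_add_one, ← h1]
      simp [letterVal]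
  have hneg : ∀ n : ℕ, ∀ b, ∃ t : Word Bool, dev M t = altZ M (-n) b ∧ t.length = n := by
    intro n
    induction n with
    | zero => intro b; exact ⟨[], by simp⟩
    | succ n ih =>
      intro b
      obtain ⟨t, h1, h2⟩ := ih (!b)
      refine ⟨(!b, false) :: t, ?_, by simp [h2]⟩
      have := altZ_add_one (M := M) (-((n + 1 : ℕ) : ℤ)) (!b)
      have e : (-((n + 1 : ℕ) : ℤ)) + 1 = -n := by push_cast; ring
      rw [e, Bool.not_not] at this
      have h3 : dev M ((!b, false) :: t) = (dgen M !b)⁻¹ * dev M t := by simp [letterVal]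
      rw [h3, h1, this]
      simp
  rcases Int.natAbs_eq N with h | h
  · obtain ⟨t, h1, h2⟩ := hpos N.natAbs b
    exact ⟨t, by rw [h1, ← h], h2⟩
  · obtain ⟨t, h1, h2⟩ := hneg N.natAbs b
    exact ⟨t, by rw [h1, ← h], h2⟩

/-- The Garside element. -/
def garside (M : ℕ) : Dih M := altMul (dgen M) M true

theorem garside_mul_altZ (N : ℤ) (b : Bool) :
    garside M * altZ M N b = altZ M (N + M) (tog b M) := by
  rw [add_comm, altZ_nat_add, altMul_dgen, tog_tog]
  congr 2
  simp [tog]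

theorem garside_mul_altMul (n : ℕ) (b : Bool) :
    garside M * altMul (dgen M) n b = altMul (dgen M) n (tog b M) * garside M := by
  have h1 := altMul_add (dgen M) M n (tog b M)
  have h2 := altMul_add (dgen M) n M (tog b M)
  have h3 : tog (tog b M) M = b := by simp [tog]
  rw [altMul_dgen, h3] at h1
  rw [altMul_dgen] at h2
  rw [garside, ← h1, add_comm, h2]

/-- The element with given normal form. -/
def stateVal (M : ℕ) : Bool → List ℕ → ℤ → Dih M
  | e, [], N => altZ M N (!e)
  | e, r :: R, N => altMul (dgen M) r (!e) * stateVal M (tog e (r + 1)) R N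

theorem garside_mul_stateVal (e : Bool) (R : List ℕ) (N : ℤ) :
    garside M * stateVal M e R N = stateVal M (tog e M) R (N + M) := by
  induction R generalizing e with
  | nil => rw [stateVal, stateVal, garside_mul_altZ, tog_not]
  | cons r R ih =>
    rw [stateVal, stateVal, ← mul_assoc, garside_mul_altMul, mul_assoc, ih, tog_not, tog_tog,
      tog_tog, add_comm]

theorem stateVal_pushPos (hM : 2 ≤ M) (b : Bool) (s : RunState) (hs : ValidState M s) :
    stateVal M (pushPos M b s).1 (pushPos M b s).2.1 (pushPos M b s).2.2
      = dgen M b * stateVal M s.1 s.2.1 s.2.2 := by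
  obtain ⟨e, R, N⟩ := s
  have hnew : ∀ R, stateVal M e (1 :: R) N = dgen M (!e) * stateVal M e R N := by
    intro R
    rw [stateVal, tog_add_two e 0]
    simp [altMul]
  by_cases h : b = e
  · subst h
    rcases R with _ | ⟨r, R⟩
    · simp [pushPos, stateVal, altZ_add_one]
    · have h1 := hs r (by simp)
      by_cases h2 : r + 1 < M
      · simp only [pushPos, h2, if_true, stateVal, Bool.not_not, altMul, mul_assoc]
        rw [tog_not, tog_succ b (r + 1), Bool.not_not]
      · have h3 : r + 1 = M := by omega
        simp only [pushPos, h2, if_true, if_false, stateVal]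
        have h4 : dgen M b * altMul (dgen M) r (!b) = garside M := by
          rw [garside, ← altMul_dgen M b, ← h3]; rfl
        rw [← mul_assoc, h4, garside_mul_stateVal, tog_tog]
        congr 1
        subst h3
        simp [tog]
  · have hb : b = !e := by revert h; cases b <;> cases e <;> simp
    subst hb
    rcases R with _ | ⟨r, R⟩ <;> simp [pushPos, hnew]

/-- Valid normal forms. -/
abbrev DState (M : ℕ) : Type := {s : RunState // ValidState M s}

/-- Left multiplication by a generator as a permutation of normal forms. -/
def pushPerm (hM : 2 ≤ M) (b : Bool) : Equiv.Perm (DState M) where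
  toFun s := ⟨pushPos M b s.1, s.2.pushPos hM b⟩
  invFun s := ⟨pushNeg M b s.1, s.2.pushNeg hM b⟩
  left_inv s := Subtype.ext (pushNeg_pushPos hM s.2 b)
  right_inv s := Subtype.ext (pushPos_pushNeg hM s.2 b)

theorem altMul_pushPerm (hM : 2 ≤ M) (n : ℕ) (b : Bool) (s : DState M) :
    (altMul (pushPerm hM) n b s).1 = pushAlt M n (tog b (n + 1)) s.1 := by
  induction n generalizing b with
  | zero => simp [altMul, pushAlt]
  | succ n ih =>
    rw [pushAlt_add, altMul, Equiv.Perm.mul_apply, tog_add_two, pushAlt, pushAlt]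
    change pushPos M b (altMul (pushPerm hM) n (!b) s).1 = _
    rw [ih, tog_tog, tog_not, tog_succ, Bool.not_not]
    congr 1
    simp [tog, Nat.bodd_add]

/-- The action of the dihedral Artin group on normal forms. -/
def dihAct (hM : 2 ≤ M) : Dih M →* Equiv.Perm (DState M) :=
  dihLift (pushPerm hM) (by
    ext1 s
    apply Subtype.ext
    rw [altMul_pushPerm, altMul_pushPerm, pushAlt_self hM _ _ s.2, pushAlt_self hM _ _ s.2])

/-- The normal form of an element of the dihedral Artin group. -/
def stateOf (hM : 2 ≤ M) (h : Dih M) : DState M :=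
  dihAct hM h ⟨(true, [], 0), by simp [ValidState]⟩

theorem stateOf_gen_mul (hM : 2 ≤ M) (b : Bool) (h : Dih M) :
    (stateOf hM (dgen M b * h)).1 = pushPos M b (stateOf hM h).1 := by
  simp [stateOf, dihAct, pushPerm]

theorem stateOf_gen_inv_mul (hM : 2 ≤ M) (b : Bool) (h : Dih M) :
    (stateOf hM ((dgen M b)⁻¹ * h)).1 = pushNeg M b (stateOf hM h).1 := by
  simp only [stateOf, dihAct, map_mul, map_inv, dihLift_dgen, Equiv.Perm.mul_apply]
  rfl

theorem dih_eq_evalWord {X : Type*} {m : X → X → ℕ∞} (g : ArtinGroup m) :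
    ∃ t : Word X, evalWord (artinGen m) t = g := by
  obtain ⟨w, rfl⟩ := PresentedGroup.mk_surjective _ g
  have e : PresentedGroup.mk (artinRels m) = FreeGroup.lift (artinGen m) := by
    ext x; simp [artinGen, PresentedGroup.of]
  obtain ⟨t, rfl⟩ := Quot.exists_rep w
  refine ⟨t, ?_⟩
  rw [e]
  change _ = FreeGroup.lift (artinGen m) (FreeGroup.mk t)
  rw [FreeGroup.lift_mk, evalWord]
  congr 2
  funext p
  rcases p with ⟨x, _ | _⟩ <;> rfl

end DihedralGroup

section Potentials

/-- The tent function of height `p`. -/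
def tent (p l : ℤ) : ℤ := min l (2 * p - l)

/-- The contribution of the final alternating run to the potential. -/
def tailPot (M p : ℕ) (N : ℤ) : ℤ := (2 * p - M) * (N / M) + tent p (N % M)

/-- A lower bound for word length in the dihedral Artin group, in terms of normal forms. -/
def pot (M p : ℕ) (s : RunState) : ℤ := (s.2.1.map fun r : ℕ => tent p r).sum + tailPot M p s.2.2

variable {M p : ℕ}

theorem tailPot_add_self (hM : 2 ≤ M) (N : ℤ) :
    tailPot M p (N + M) = tailPot M p N + 2 * p - M := by
  have h : (M : ℤ) ≠ 0 := by omega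
  have h1 : (N + M) / M = N / M + 1 := by
    simpa using Int.add_mul_ediv_right N 1 h
  rw [tailPot, tailPot, h1, Int.add_emod_right]
  ring

theorem tailPot_sub_self (hM : 2 ≤ M) (N : ℤ) :
    tailPot M p (N - M) = tailPot M p N - (2 * p - M) := by
  have := tailPot_add_self (p := p) hM (N - M)
  rw [sub_add_cancel] at this
  linarith

theorem tailPot_succ (hM : 2 ≤ M) (hp : p ≤ M) (N : ℤ) :
    tailPot M p (N + 1) = tailPot M p N + if N % M < p then 1 else -1 := by
  have hpos : (0 : ℤ) < M := by omega
  have h0 := Int.emod_nonneg N hpos.ne'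
  have h1 := Int.emod_lt_of_pos N hpos
  have h2 := Int.mul_ediv_add_emod N M
  set q := N / M
  set r := N % M
  by_cases hr : r + 1 < M
  · have h3 : (N + 1) / M = q ∧ (N + 1) % M = r + 1 :=
      (Int.ediv_emod_unique hpos).2 ⟨by rw [← h2]; ring, by omega, hr⟩
    rw [tailPot, tailPot, h3.1, h3.2, add_assoc]
    congr 1
    change _ = tent p r + _
    unfold tent
    split_ifs <;> omega
  · have h3 : (N + 1) / M = q + 1 ∧ (N + 1) % M = 0 :=
      (Int.ediv_emod_unique hpos).2 ⟨by rw [← h2]; linarith [show r = M - 1 by omega], le_rfl, hpos⟩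
    rw [tailPot, tailPot, h3.1, h3.2, mul_add, add_assoc, add_assoc]
    congr 1
    change _ = tent p r + _
    have : r = M - 1 := by omega
    unfold tent
    split_ifs <;> omega

theorem tailPot_zero : tailPot M p 0 = 0 := by simp [tailPot, tent]

theorem tailPot_zero_left (hM : 2 ≤ M) (N : ℤ) : tailPot M 0 N = -N := by
  have hpos : (0 : ℤ) < M := by omega
  have h0 := Int.emod_nonneg N hpos.ne'
  have h2 := Int.mul_ediv_add_emod N M
  rw [tailPot, tent]
  push_cast
  rw [min_eq_right (by omega)]
  linarith

theorem tailPot_self (hM : 2 ≤ M) (N : ℤ) : tailPot M M N = N := by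
  have hpos : (0 : ℤ) < M := by omega
  have h1 := Int.emod_lt_of_pos N hpos
  have h2 := Int.mul_ediv_add_emod N M
  rw [tailPot, tent, min_eq_left (by omega)]
  linarith

theorem pot_pushPos_bounds (hM : 2 ≤ M) (hp : p ≤ M) (b : Bool) (s : RunState)
    (hs : ValidState M s) :
    pot M p (pushPos M b s) ≤ pot M p s + 1 ∧ pot M p s ≤ pot M p (pushPos M b s) + 1 := by
  obtain ⟨e, _ | ⟨r, R⟩, N⟩ := s
  · by_cases h : b = e
    · simp only [pushPos, h, if_true, pot, tailPot_succ hM hp]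
      split_ifs <;> constructor <;> linarith
    · simp only [pushPos, h, if_false, pot, List.map_cons, List.sum_cons, List.map_nil,
        List.sum_nil, tent]
      omega
  · have h1 := hs r (by simp)
    by_cases h : b = e
    · by_cases h2 : r + 1 < M
      · simp only [pushPos, h, h2, if_true, pot, List.map_cons, List.sum_cons, tent]
        omega
      · simp only [pushPos, h, h2, if_true, if_false, pot, List.map_cons, List.sum_cons, tent,
          tailPot_add_self hM]
        omega
    · simp only [pushPos, h, if_false, pot, List.map_cons, List.sum_cons, tent]
      omega

theorem pot_pushNeg_bounds (hM : 2 ≤ M) (hp : p ≤ M) (b : Bool) (s : RunState)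
    (hs : ValidState M s) :
    pot M p (pushNeg M b s) ≤ pot M p s + 1 := by
  have := (pot_pushPos_bounds hM hp b _ (hs.pushNeg hM b)).2
  rwa [pushPos_pushNeg hM hs] at this

theorem pot_not_local_max (hM : 2 ≤ M) (hp : p ≤ M) (b : Bool) (s : RunState)
    (hs : ValidState M s) :
    pot M p s ≤ pot M p (pushPos M b s) ∨ pot M p s ≤ pot M p (pushNeg M b s) := by
  obtain ⟨e, _ | ⟨r, R⟩, N⟩ := s
  · by_cases h : b = e
    · by_cases hpM : p = M
      · left
        subst hpM
        simp [pushPos, h, pot, tailPot_self hM]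
      · right
        simp only [pushNeg, h, if_true, pot, List.map_cons, List.sum_cons, List.map_nil,
          List.sum_nil, tent, tailPot_sub_self hM]
        omega
    · by_cases hp0 : p = 0
      · right
        subst hp0
        simp [pushNeg, h, pot, tailPot_zero_left hM]
      · left
        simp only [pushPos, h, if_false, pot, List.map_cons, List.sum_cons, List.map_nil,
          List.sum_nil, tent]
        omega
  · have h1 := hs r (by simp)
    by_cases h : b = e
    · by_cases hpM : p = M
      · left
        by_cases h2 : r + 1 < M
        · simp only [pushPos, h, h2, if_true, pot, List.map_cons, List.sum_cons, tent]
          omega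
        · simp only [pushPos, h, h2, if_true, if_false, pot, List.map_cons, List.sum_cons, tent,
            tailPot_add_self hM]
          omega
      · right
        simp only [pushNeg, h, if_true, pot, List.map_cons, List.sum_cons, tent,
          tailPot_sub_self hM]
        omega
    · by_cases hp0 : p = 0
      · right
        subst hp0
        by_cases h2 : r = 1
        · simp [pushNeg, h, h2, pot, tent]
        · simp only [pushNeg, h, h2, if_false, pot, List.map_cons, List.sum_cons, tent]
          omega
      · left
        simp only [pushPos, h, if_false, pot, List.map_cons, List.sum_cons, tent]
        omega

/-- The potential of an element. -/
def hpot (hM : 2 ≤ M) (p : ℕ) (h : Dih M) : ℤ := pot M p (stateOf hM h).1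

theorem hpot_dev_le (hM : 2 ≤ M) (hp : p ≤ M) (t : Word Bool) :
    hpot hM p (dev M t) ≤ t.length := by
  induction t with
  | nil => simp [hpot, stateOf, pot, tailPot_zero]
  | cons a t ih =>
    rcases a with ⟨b, _ | _⟩
    · have h := pot_pushNeg_bounds hM hp b _ (stateOf hM (dev M t)).2
      rw [← stateOf_gen_inv_mul] at h
      have e : dev M ((b, false) :: t) = (dgen M b)⁻¹ * dev M t := by simp [letterVal]
      rw [e, hpot, List.length_cons]
      push_cast
      unfold hpot at ih
      linarith
    · have h := (pot_pushPos_bounds hM hp b _ (stateOf hM (dev M t)).2).1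
      rw [← stateOf_gen_mul] at h
      have e : dev M ((b, true) :: t) = dgen M b * dev M t := by simp [letterVal]
      rw [e, hpot, List.length_cons]
      push_cast
      unfold hpot at ih
      linarith

theorem stateVal_stateOf (hM : 2 ≤ M) (h : Dih M) :
    stateVal M (stateOf hM h).1.1 (stateOf hM h).1.2.1 (stateOf hM h).1.2.2 = h := by
  obtain ⟨t, rfl⟩ := dih_eq_evalWord h
  change stateVal M (stateOf hM (dev M t)).1.1 (stateOf hM (dev M t)).1.2.1
    (stateOf hM (dev M t)).1.2.2 = dev M t
  induction t with
  | nil => simp [stateOf, stateVal]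
  | cons a t ih =>
    rcases a with ⟨b, _ | _⟩
    · have e : dev M ((b, false) :: t) = (dgen M b)⁻¹ * dev M t := by simp [letterVal]
      rw [e, stateOf_gen_inv_mul]
      have h := stateVal_pushPos hM b _ ((stateOf hM (dev M t)).2.pushNeg hM b)
      rw [pushPos_pushNeg hM (stateOf hM (dev M t)).2, ih] at h
      rw [eq_inv_mul_iff_mul_eq, ← h]
    · have e : dev M ((b, true) :: t) = dgen M b * dev M t := by simp [letterVal]
      rw [e, stateOf_gen_mul, stateVal_pushPos hM b _ (stateOf hM (dev M t)).2, ih]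

theorem exists_peak (g σ : ℕ → ℤ) (hσ : Antitone σ) (hg : ∀ p, g (p + 1) = g p + 2 * σ p)
    {M r : ℕ} (hr : 1 ≤ r) (hrM : r ≤ M) :
    ∃ p ≤ M, (r ≤ p ∧ ∀ q ≤ M, g q ≤ g p) ∨ (p ≤ r ∧ ∀ q ≤ M, g q + 2 * q ≤ g p + 2 * p) := by
  obtain ⟨r, rfl⟩ : ∃ i, r = i + 1 := ⟨r - 1, by omega⟩
  by_cases h : 0 ≤ σ r
  · obtain ⟨p, hp, hmax⟩ := Finset.exists_max_image (Finset.Icc (r + 1) M) g ⟨r + 1, by simp [hrM]⟩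
    rw [Finset.mem_Icc] at hp
    refine ⟨p, hp.2, Or.inl ⟨hp.1, fun q hq => ?_⟩⟩
    by_cases hq' : r + 1 ≤ q
    · exact hmax q (by simp [hq, hq'])
    · refine le_trans ?_ (hmax (r + 1) (by simp [hrM]))
      have : ∀ i, ∀ q, q + i = r + 1 → g q ≤ g (r + 1) := by
        intro i
        induction i with
        | zero => intro q hq; rw [← hq]; simp
        | succ i ih =>
          intro q hq
          have := ih (q + 1) (by omega)
          have := hg q
          have := hσ (show q ≤ r by omega)
          linarith
      exact this (r + 1 - q) q (by omega)
  · obtain ⟨p, hp, hmax⟩ := Finset.exists_max_image (Finset.Icc 0 (r + 1))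
      (fun q => g q + 2 * q) ⟨r + 1, by simp⟩
    rw [Finset.mem_Icc] at hp
    refine ⟨p, by omega, Or.inr ⟨hp.2, fun q hq => ?_⟩⟩
    by_cases hq' : q ≤ r + 1
    · exact hmax q (by simp [hq'])
    · refine le_trans ?_ (hmax (r + 1) (by simp))
      have : ∀ i : ℕ, g (r + 1 + i) + 2 * ((r + 1 + i : ℕ) : ℤ) ≤ g (r + 1) + 2 * ((r + 1 : ℕ) : ℤ) := by
        intro i
        induction i with
        | zero => simp
        | succ i ih =>
          have h1 := hg (r + 1 + i)
          have h2 := hσ (show r ≤ r + 1 + i by omega)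
          rw [← add_assoc]
          push_cast at ih ⊢
          linarith [show σ r ≤ -1 by omega]
      have h3 := this (q - (r + 1))
      rwa [show r + 1 + (q - (r + 1)) = q by omega] at h3

/-- Half the increment of the potential as the height grows. -/
def potSlope (M : ℕ) (R : List ℕ) (N : ℤ) (p : ℕ) : ℤ :=
  (R.map fun r => if p < r then (1 : ℤ) else 0).sum + N / M + if (p : ℤ) < N % M then 1 else 0

theorem potSlope_antitone (R : List ℕ) (N : ℤ) : Antitone (potSlope M R N) := by
  refine antitone_nat_of_succ_le fun p => ?_
  have h1 : (R.map fun r => if p + 1 < r then (1 : ℤ) else 0).sum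
      ≤ (R.map fun r => if p < r then (1 : ℤ) else 0).sum := by
    refine List.sum_le_sum fun r _ => ?_
    split_ifs <;> omega
  have h2 : (if ((p + 1 : ℕ) : ℤ) < N % M then (1 : ℤ) else 0)
      ≤ if (p : ℤ) < N % M then 1 else 0 := by
    split_ifs <;> omega
  unfold potSlope
  linarith

theorem pot_succ_height (e : Bool) (R : List ℕ) (N : ℤ) (p : ℕ) :
    pot M (p + 1) (e, R, N) = pot M p (e, R, N) + 2 * potSlope M R N p := by
  have ht : ∀ l : ℤ, tent ((p + 1 : ℕ) : ℤ) l = tent p l + 2 * if (p : ℤ) < l then 1 else 0 := by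
    intro l
    unfold tent
    split_ifs <;> omega
  have h1 : (R.map fun r : ℕ => tent ((p + 1 : ℕ) : ℤ) r).sum
      = (R.map fun r : ℕ => tent p r).sum
        + 2 * (R.map fun r => if p < r then (1 : ℤ) else 0).sum := by
    induction R with
    | nil => simp
    | cons r R ih =>
      rw [List.map_cons, List.sum_cons, ih, ht, List.map_cons, List.sum_cons, List.map_cons,
        List.sum_cons]
      simp only [Nat.cast_lt]
      ring
  simp only [pot]
  rw [h1, tailPot, tailPot, potSlope, ht]
  push_cast
  ring

theorem exists_word_le_pot (hM : 2 ≤ M) (R : List ℕ) (e : Bool) (N : ℤ)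
    (hs : ∀ r ∈ R, 1 ≤ r ∧ r < M) :
    ∃ t : Word Bool, ∃ p ≤ M, dev M t = stateVal M e R N ∧ (t.length : ℤ) ≤ pot M p (e, R, N) := by
  have hpos : ∀ n b, ∃ t : Word Bool, dev M t = altMul (dgen M) n b ∧ t.length = n := by
    intro n
    induction n with
    | zero => intro b; exact ⟨[], by simp [altMul]⟩
    | succ n ih =>
      intro b
      obtain ⟨t, h1, h2⟩ := ih (!b)
      exact ⟨(b, true) :: t, by rw [altMul, ← h1]; simp [letterVal], by simp [h2]⟩
  induction R generalizing e N with
  | nil =>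
    obtain ⟨t, h1, h2⟩ := altZ_length (M := M) N (!e)
    rcases le_total 0 N with h | h
    · exact ⟨t, M, le_rfl, h1, by simp [pot, tailPot_self hM]; omega⟩
    · exact ⟨t, 0, by omega, h1, by simp [pot, tailPot_zero_left hM]; omega⟩
  | cons r R ih =>
    have hr := hs r (by simp)
    have hR : ∀ r ∈ R, 1 ≤ r ∧ r < M := fun q hq => hs q (by simp [hq])
    have hind : ∀ p e e' N, pot M p (e, R, N) = pot M p (e', R, N) := fun _ _ _ _ => rfl
    obtain ⟨p, hpM, ⟨hp, hmax⟩ | ⟨hp, hmax⟩⟩ := exists_peak (fun p => pot M p (e, R, N))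
      (potSlope M R N) (potSlope_antitone R N) (pot_succ_height e R N) hr.1 hr.2.le
    · obtain ⟨t, q, hq, h1, h2⟩ := ih (tog e (r + 1)) N hR
      obtain ⟨u, h3, h4⟩ := hpos r (!e)
      refine ⟨u ++ t, p, hpM, ?_, ?_⟩
      · rw [stateVal, ← h1, ← h3, dev, evalWord_append]
      · have h5 := hmax q hq
        have h6 : pot M p (e, r :: R, N) = tent p r + pot M p (e, R, N) := by
          simp [pot]; ring
        rw [h6, List.length_append, h4]
        push_cast
        simp only [tent]
        have := hind q (tog e (r + 1)) e N
        change pot M q (e, R, N) ≤ pot M p (e, R, N) at h5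
        omega
    · obtain ⟨t, q, hq, h1, h2⟩ := ih (tog (tog e (r + 1)) M) (N + M) hR
      obtain ⟨u, h3, h4⟩ := hpos (M - r) (tog (!e) (r + M))
      refine ⟨invWord u ++ t, p, hpM, ?_, ?_⟩
      · rw [stateVal, dev, evalWord_append, evalWord_invWord]
        change (dev M u)⁻¹ * dev M t = _
        rw [h1, h3, inv_mul_eq_iff_eq_mul, ← garside_mul_stateVal, ← mul_assoc]
        congr 1
        have h5 := altMul_add (dgen M) (M - r) r (tog (!e) (r + M))
        rw [Nat.sub_add_cancel hr.2.le, altMul_dgen] at h5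
        rw [garside, h5, tog_tog]
        congr 2
        rw [show r + M + (M - r) = M + M by omega, ← tog_tog]
        simp [tog]
      · have h5 := hmax q hq
        have h6 : pot M p (e, r :: R, N) = tent p r + pot M p (e, R, N) := by
          simp [pot]; ring
        have h7 : pot M q (tog (tog e (r + 1)) M, R, N + M) = pot M q (e, R, N) + 2 * q - M := by
          simp only [pot, tailPot_add_self hM]; ring
        rw [h6, List.length_append, invWord_length, h4]
        push_cast [hr.2.le]
        simp only [tent]
        change pot M q (e, R, N) + 2 * q ≤ pot M p (e, R, N) + 2 * p at h5
        omega

theorem DGeo.exists_hpot (hM : 2 ≤ M) {s : Word Bool} (h : DGeo M s) :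
    ∃ p ≤ M, hpot hM p (dev M s) = s.length := by
  obtain ⟨t, p, hp, h1, h2⟩ := exists_word_le_pot hM (stateOf hM (dev M s)).1.2.1
    (stateOf hM (dev M s)).1.1 (stateOf hM (dev M s)).1.2.2 (stateOf hM (dev M s)).2
  rw [stateVal_stateOf] at h1
  refine ⟨p, hp, le_antisymm (hpot_dev_le hM hp s) ?_⟩
  have := h t h1
  unfold hpot
  exact le_trans (by exact_mod_cast this) h2

theorem dev_ne_of_geo_flip (hM : 2 ≤ M) {a : Bool × Bool} {s t : Word Bool}
    (hs : DGeo M (a :: s)) (ht : DGeo M (flipSign a :: t)) :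
    dev M (a :: s) ≠ dev M (flipSign a :: t) := by
  intro he
  have hl := IsGeodesic.length_eq hs ht he
  simp only [List.length_cons, add_left_inj] at hl
  obtain ⟨p, hp, h⟩ := DGeo.exists_hpot hM hs
  have h1 := hpot_dev_le hM hp s
  have h2 := hpot_dev_le hM hp t
  rw [List.length_cons] at h
  push_cast at h
  have e1 : dev M s = letterVal (dgen M) (flipSign a) * dev M (a :: s) := by simp
  have e2 : dev M t = letterVal (dgen M) a * dev M (a :: s) := by rw [he]; simp
  have h3 := pot_not_local_max hM hp a.1 _ (stateOf hM (dev M (a :: s))).2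
  rw [← stateOf_gen_mul, ← stateOf_gen_inv_mul] at h3
  rcases a with ⟨b, _ | _⟩ <;> simp only [letterVal, flipSign] at e1 e2 <;>
    simp only [Bool.not_true, Bool.not_false, if_true] at e1 e2 <;>
    simp only [Bool.false_eq_true, if_false] at e1 e2 <;>
    rw [← e1, ← e2] at h3 <;>
    unfold hpot at h h1 h2 <;> rcases h3 with h3 | h3 <;> omega

theorem exists_strip {a : Bool × Bool} {s : Word Bool} (hs : DGeo M s)
    (ha : ¬ DGeo M (a :: s)) :
    ∃ t, DGeo M (flipSign a :: t) ∧ dev M s = dev M (flipSign a :: t) ∧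
      t.length + 1 = s.length := by
  unfold DGeo IsGeodesic at ha
  push Not at ha
  obtain ⟨v, h1, h2⟩ := ha
  have h3 := dev_length_parity h1
  have h4 : dev M s = dev M (flipSign a :: v) := by
    change evalWord _ v = _ at h1
    rw [dev, dev, evalWord_cons, h1]; simp
  have h5 := hs _ h4.symm
  simp only [List.length_cons] at h2 h3 h5
  have h6 : v.length + 1 = s.length := by omega
  exact ⟨v, IsGeodesic.of_eq hs h4.symm (by simp [h6]), h4, h6⟩

end Potentials

section Syllables

/-- The number of changes of letter in a word preceded by the letter `c`. -/
def chg (c : Bool) : Word Bool → ℕ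
  | [] => 0
  | a :: s => (if a.1 = c then 0 else 1) + chg a.1 s

/-- The number of syllables of a word in two letters. -/
def syl : Word Bool → ℕ
  | [] => 0
  | a :: s => 1 + chg a.1 s

/-- The number of syllables of sign `ε` in a word preceded by the letter `c`. -/
def chgSign (ε c : Bool) : Word Bool → ℕ
  | [] => 0
  | a :: s => (if a.1 ≠ c ∧ a.2 = ε then 1 else 0) + chgSign ε a.1 s

/-- The number of syllables of sign `ε`. -/
def sylSign (ε : Bool) : Word Bool → ℕ
  | [] => 0
  | a :: s => (if a.2 = ε then 1 else 0) + chgSign ε a.1 s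

theorem chgSign_add (c : Bool) (s : Word Bool) :
    chgSign true c s + chgSign false c s = chg c s := by
  induction s generalizing c with
  | nil => rfl
  | cons a s ih =>
    have := ih a.1
    rcases a with ⟨b, _ | _⟩ <;> simp [chgSign, chg] at this ⊢ <;> split_ifs <;> omega

theorem sylSign_add (s : Word Bool) : sylSign true s + sylSign false s = syl s := by
  cases s with
  | nil => rfl
  | cons a s =>
    have := chgSign_add a.1 s
    rcases a with ⟨b, _ | _⟩ <;> simp [sylSign, syl] at this ⊢ <;> omega

/-- Freely reduced words. -/
def Reduced (s : Word Bool) : Prop := s.IsChain fun p q => q ≠ flipSign p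

variable {M : ℕ}

theorem DGeo.reduced {s : Word Bool} (h : DGeo M s) : Reduced s := by
  induction s with
  | nil => exact List.isChain_nil
  | cons a s ih =>
    have ih := ih (IsGeodesic.tail h)
    cases s with
    | nil => exact List.isChain_singleton _
    | cons b s =>
      refine List.isChain_cons_cons.2 ⟨?_, ih⟩
      rintro rfl
      have := h s (by simp)
      simp at this

/-- Left multiplication of a normal form by a signed letter. -/
def pushLetter (M : ℕ) (a : Bool × Bool) (st : RunState) : RunState :=
  if a.2 then pushPos M a.1 st else pushNeg M a.1 st

theorem stateOf_cons (hM : 2 ≤ M) (a : Bool × Bool) (s : Word Bool) :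
    (stateOf hM (dev M (a :: s))).1 = pushLetter M a (stateOf hM (dev M s)).1 := by
  rcases a with ⟨b, _ | _⟩
  · have e : dev M ((b, false) :: s) = (dgen M b)⁻¹ * dev M s := by simp [letterVal]
    rw [e, stateOf_gen_inv_mul]; simp [pushLetter]
  · have e : dev M ((b, true) :: s) = dgen M b * dev M s := by simp [letterVal]
    rw [e, stateOf_gen_mul]; simp [pushLetter]

/-- The shape of the normal form of a reduced word with few syllables. -/
def HeadShape (M : ℕ) : Word Bool → RunState → Prop
  | [], st => st = (true, [], 0)
  | (b, true) :: s, (e, [], N) => e = !b ∧ 0 ≤ N ∧ N ≤ sylSign true ((b, true) :: s)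
  | (b, true) :: s, (e, r :: _, _) => e = !b ∧ r ≤ sylSign true ((b, true) :: s)
  | (b, false) :: s, (e, [], N) => e = b ∧ N ≤ 0 ∧ -N ≤ sylSign false ((b, false) :: s)
  | (b, false) :: s, (e, r :: _, _) => e = b ∧ M ≤ r + sylSign false ((b, false) :: s)

theorem tailPot_succ_of_nonneg {p : ℕ} (hM : 2 ≤ M) (hp : p ≤ M) {N : ℤ} (h0 : 0 ≤ N)
    (h1 : N < p) : tailPot M p (N + 1) = tailPot M p N + 1 := by
  rw [tailPot_succ hM hp, Int.emod_eq_of_lt h0 (by omega), if_pos h1]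

theorem tailPot_pred_of_nonpos {p : ℕ} (hM : 2 ≤ M) (hp : p ≤ M) {N : ℤ} (h0 : N ≤ 0)
    (h1 : p - M < N) : tailPot M p (N - 1) = tailPot M p N + 1 := by
  have h := tailPot_succ hM hp (N - 1)
  have h2 : (N - 1) % M = N - 1 + M := by
    rw [← Int.add_emod_right, Int.emod_eq_of_lt (by omega) (by omega)]
  rw [h2, if_neg (by omega), sub_add_cancel] at h
  omega

theorem pot_pushLetter {p : ℕ} (hM : 2 ≤ M) (hp : p ≤ M) {a : Bool × Bool} {s : Word Bool}
    {st : RunState} (hst : ValidState M st) (hs : HeadShape M s st) (hred : Reduced (a :: s))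
    (h1 : sylSign true (a :: s) ≤ p) (h2 : sylSign false (a :: s) + p ≤ M) :
    pot M p (pushLetter M a st) = pot M p st + 1 := by
  obtain ⟨e, R, N⟩ := st
  obtain ⟨b, ε⟩ := a
  rcases s with _ | ⟨⟨c, δ⟩, s⟩
  · simp only [HeadShape, Prod.mk.injEq] at hs
    obtain ⟨rfl, rfl, rfl⟩ := hs
    have t0 := tailPot_zero (M := M) (p := p)
    have t1 := tailPot_sub_self (p := p) hM 0
    cases b <;> cases ε <;> simp [sylSign, chgSign] at h1 h2 <;>
      simp [pushLetter, pushPos, pushNeg, pot, tent] at t0 t1 ⊢ <;> try omega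
    · have := tailPot_pred_of_nonpos (p := p) hM hp le_rfl (by omega)
      rw [zero_sub] at this
      omega
    · have := tailPot_succ_of_nonneg (p := p) hM hp le_rfl (by omega)
      rw [zero_add] at this
      omega
  · have hred := (List.isChain_cons_cons.1 hred).1
    have t1 := tailPot_sub_self (p := p) hM N
    have t2 := tailPot_add_self (p := p) hM N
    have t3 := fun h0 h1 => tailPot_succ_of_nonneg (p := p) (N := N) hM hp h0 h1
    have t4 := fun h0 h1 => tailPot_pred_of_nonpos (p := p) (N := N) hM hp h0 h1
    rcases R with _ | ⟨r, R⟩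
    · cases b <;> cases ε <;> cases c <;> cases δ <;>
        simp [HeadShape, flipSign] at hs hred <;> obtain ⟨rfl, hs⟩ := hs <;>
        simp [sylSign, chgSign] at hs h1 h2 <;>
        simp [pushLetter, pushPos, pushNeg, pot, tent] <;>
        omega
    · have hr := hst r (by simp)
      cases b <;> cases ε <;> cases c <;> cases δ <;>
        simp [HeadShape, flipSign] at hs hred <;> obtain ⟨rfl, hs⟩ := hs <;>
        simp [sylSign, chgSign] at hs h1 h2 <;>
        simp [pushLetter, pushPos, pushNeg] <;>
        (try split_ifs) <;> simp [pot, tent] <;> omega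

theorem headShape_pushLetter (hM : 2 ≤ M) {a : Bool × Bool} {s : Word Bool}
    {st : RunState} (hst : ValidState M st) (hs : HeadShape M s st) (hred : Reduced (a :: s))
    (h : syl (a :: s) < M) : HeadShape M (a :: s) (pushLetter M a st) := by
  rw [← sylSign_add] at h
  obtain ⟨e, R, N⟩ := st
  obtain ⟨b, ε⟩ := a
  rcases s with _ | ⟨⟨c, δ⟩, s⟩
  · simp only [HeadShape, Prod.mk.injEq] at hs
    obtain ⟨rfl, rfl, rfl⟩ := hs
    cases b <;> cases ε <;> simp [pushLetter, pushPos, pushNeg, HeadShape, sylSign, chgSign]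
    omega
  · have hred := (List.isChain_cons_cons.1 hred).1
    rcases R with _ | ⟨r, R⟩
    · cases b <;> cases ε <;> cases c <;> cases δ <;>
        simp [HeadShape, flipSign] at hs hred <;> obtain ⟨rfl, hs⟩ := hs <;>
        simp [pushLetter, pushPos, pushNeg, HeadShape, sylSign, chgSign] at hs h ⊢ <;> omega
    · have hr := hst r (by simp)
      cases b <;> cases ε <;> cases c <;> cases δ <;>
        simp [HeadShape, flipSign] at hs hred <;> obtain ⟨rfl, hs⟩ := hs <;>
        simp [pushLetter, pushPos, pushNeg, sylSign, chgSign] at hs h ⊢ <;>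
        (try split_ifs) <;> simp [HeadShape, sylSign, chgSign] <;> omega

theorem sylSign_le_cons (ε : Bool) {a : Bool × Bool} {s : Word Bool}
    (h : Reduced (a :: s)) : sylSign ε s ≤ sylSign ε (a :: s) := by
  rcases s with _ | ⟨b, s⟩
  · simp [sylSign]
  · rcases a with ⟨a1, a2⟩
    rcases b with ⟨b1, b2⟩
    have := (List.isChain_cons_cons.1 h).1
    simp only [sylSign, chgSign]
    split_ifs <;> simp_all [flipSign]

theorem hpot_of_reduced {p : ℕ} (hM : 2 ≤ M) {s : Word Bool} (hred : Reduced s) (h : syl s < M)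
    (h1 : sylSign true s ≤ p) (h2 : sylSign false s + p ≤ M) :
    HeadShape M s (stateOf hM (dev M s)).1 ∧ hpot hM p (dev M s) = s.length := by
  induction s with
  | nil => simp [stateOf, HeadShape, hpot, pot, tailPot_zero]
  | cons a s ih =>
    have m1 := sylSign_le_cons true hred
    have m2 := sylSign_le_cons false hred
    have m3 := sylSign_add s
    have m4 := sylSign_add (a :: s)
    obtain ⟨h3, h4⟩ := ih hred.tail (by omega) (by omega) (by omega)
    rw [hpot, stateOf_cons]
    refine ⟨headShape_pushLetter hM (stateOf hM _).2 h3 hred h, ?_⟩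
    rw [pot_pushLetter hM (by omega) (stateOf hM _).2 h3 hred h1 h2]
    unfold hpot at h4
    rw [h4]
    simp

theorem dgeo_of_syl_le (hM : 2 ≤ M) {a : Bool × Bool} {s : Word Bool} (hred : Reduced (a :: s))
    (h : syl s < M) (h' : syl (a :: s) ≤ M) : DGeo M (a :: s) := by
  have m1 := sylSign_le_cons true hred
  have m2 := sylSign_le_cons false hred
  have m4 := sylSign_add (a :: s)
  have hp : sylSign true (a :: s) ≤ M := by omega
  obtain ⟨h3, h4⟩ := hpot_of_reduced (s := s) (p := sylSign true (a :: s)) hM hred.tail h m1 (by omega)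
  have h5 : hpot hM (sylSign true (a :: s)) (dev M (a :: s)) = (a :: s).length := by
    rw [hpot, stateOf_cons, pot_pushLetter hM hp (stateOf hM _).2 h3 hred le_rfl (by omega)]
    unfold hpot at h4
    rw [h4]
    simp
  intro v hv
  have h6 := hpot_dev_le hM hp v
  change dev M v = dev M (a :: s) at hv
  rw [hv, h5] at h6
  exact_mod_cast h6

theorem four_le_syl (hM : 4 ≤ M) {a b : Bool × Bool} {s t : Word Bool} (hs : DGeo M (a :: s))
    (ht : DGeo M (b :: t)) (he : dev M (a :: s) = dev M (b :: t)) (hab : a.1 ≠ b.1) :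
    4 ≤ syl (a :: s) := by
  by_contra h
  have hred : Reduced (flipSign b :: a :: s) :=
    List.isChain_cons_cons.2 ⟨fun h => hab (by rw [h]; rfl), hs.reduced⟩
  have hsyl : syl (flipSign b :: a :: s) = 1 + syl (a :: s) := by
    simp [syl, chg, hab]
  have hg := dgeo_of_syl_le (M := M) (by omega) hred (by omega) (by omega)
  have h1 := hg t (by rw [evalWord_cons]; change _ = _ * dev M (a :: s); rw [he]; simp)
  have h2 := IsGeodesic.length_eq hs ht he
  simp only [List.length_cons] at h1 h2
  omega

end Syllables

section Commuting

/-- The exponent sum of a generator, in the dihedral Artin group of label two. -/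
def expSum (b : Bool) : Dih 2 →* Multiplicative ℤ :=
  dihLift (fun c => if c = b then Multiplicative.ofAdd 1 else 1) (by cases b <;> simp [altMul])

/-- The exponent of a signed letter relative to a generator. -/
def letterExp (b : Bool) (a : Bool × Bool) : ℤ := if a.1 = b then (if a.2 then 1 else -1) else 0

theorem expSum_cons (b : Bool) (a : Bool × Bool) (s : Word Bool) :
    (expSum b (dev 2 (a :: s))).toAdd = letterExp b a + (expSum b (dev 2 s)).toAdd := by
  rw [expSum, dihLift_dev, dihLift_dev, evalWord_cons, toAdd_mul]
  congr 1
  rcases a with ⟨c, _ | _⟩ <;> by_cases h : c = b <;> simp [letterVal, letterExp, h]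

theorem dgen_two_commute (b : Bool) : Commute (dgen 2 b) (dgen 2 !b) := by
  have h := altMul_dgen 2 b
  rw [← altMul_dgen 2 (!b)] at h
  simpa [altMul, Commute, SemiconjBy] using h

theorem eq_zpow_mul_zpow (h : Dih 2) :
    h = dgen 2 true ^ (expSum true h).toAdd * dgen 2 false ^ (expSum false h).toAdd := by
  obtain ⟨t, rfl⟩ := dih_eq_evalWord h
  change dev 2 t = dgen 2 true ^ (expSum true (dev 2 t)).toAdd *
    dgen 2 false ^ (expSum false (dev 2 t)).toAdd
  induction t with
  | nil => simp
  | cons a t ih =>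
    rw [expSum_cons, expSum_cons, zpow_add, zpow_add]
    have hc : Commute (dgen 2 true) (dgen 2 false) := dgen_two_commute true
    generalize (expSum true (dev 2 t)).toAdd = i at *
    generalize (expSum false (dev 2 t)).toAdd = j at *
    have e : dev 2 (a :: t) = letterVal (dgen 2) a * dev 2 t := evalWord_cons _ _ _
    rw [e, ih]
    rcases a with ⟨_ | _, ε⟩
    · have : letterVal (dgen 2) (false, ε) = dgen 2 false ^ letterExp false (false, ε) := by
        cases ε <;> simp [letterVal, letterExp]
      rw [this]
      have h0 : letterExp true (false, ε) = 0 := by simp [letterExp]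
      rw [h0, zpow_zero, one_mul, ← mul_assoc, ← mul_assoc, (hc.symm.zpow_zpow _ _).eq]
    · have : letterVal (dgen 2) (true, ε) = dgen 2 true ^ letterExp true (true, ε) := by
        cases ε <;> simp [letterVal, letterExp]
      rw [this]
      have h0 : letterExp false (true, ε) = 0 := by simp [letterExp]
      rw [h0, zpow_zero, one_mul, ← mul_assoc]

theorem expSum_ext {g h : Dih 2} (h1 : ∀ b, (expSum b g).toAdd = (expSum b h).toAdd) : g = h := by
  rw [eq_zpow_mul_zpow g, eq_zpow_mul_zpow h, h1, h1]

theorem exists_word_expSum (i j : ℤ) :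
    ∃ t : Word Bool, (expSum true (dev 2 t)).toAdd = i ∧ (expSum false (dev 2 t)).toAdd = j ∧
      t.length = i.natAbs + j.natAbs := by
  have key : ∀ n : ℕ, ∀ i j : ℤ, i.natAbs + j.natAbs = n →
      ∃ t : Word Bool, (expSum true (dev 2 t)).toAdd = i ∧ (expSum false (dev 2 t)).toAdd = j ∧
      t.length = n := by
    intro n
    induction n with
    | zero =>
      intro i j h
      exact ⟨[], by simp; omega, by simp; omega, rfl⟩
    | succ n ih =>
      intro i j h
      by_cases hi : i = 0
      · obtain ⟨t, h1, h2, h3⟩ := ih i (if 0 < j then j - 1 else j + 1) (by split_ifs <;> omega)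
        refine ⟨(false, decide (0 < j)) :: t, ?_, ?_, by simp [h3]⟩ <;>
          rw [expSum_cons] <;> simp [h1, h2, letterExp]
        split_ifs <;> omega
      · obtain ⟨t, h1, h2, h3⟩ := ih (if 0 < i then i - 1 else i + 1) j (by split_ifs <;> omega)
        refine ⟨(true, decide (0 < i)) :: t, ?_, ?_, by simp [h3]⟩ <;>
          rw [expSum_cons] <;> simp [h1, h2, letterExp]
        split_ifs <;> omega
  exact key _ i j rfl

theorem natAbs_expSum_le (s : Word Bool) :
    (expSum true (dev 2 s)).toAdd.natAbs + (expSum false (dev 2 s)).toAdd.natAbs ≤ s.length := by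
  induction s with
  | nil => simp
  | cons a s ih =>
    rw [expSum_cons, expSum_cons, List.length_cons]
    rcases a with ⟨_ | _, _ | _⟩ <;> simp [letterExp] <;> omega

theorem dgeo_two_length {s : Word Bool} (h : DGeo 2 s) :
    s.length = (expSum true (dev 2 s)).toAdd.natAbs + (expSum false (dev 2 s)).toAdd.natAbs := by
  refine le_antisymm ?_ (natAbs_expSum_le s)
  obtain ⟨t, h1, h2, h3⟩ := exists_word_expSum (expSum true (dev 2 s)).toAdd
    (expSum false (dev 2 s)).toAdd
  rw [← h3]
  refine h t (expSum_ext fun b => ?_)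
  cases b
  · exact h2
  · exact h1

theorem exists_common_tail {a b : Bool × Bool} {s t : Word Bool} (hs : DGeo 2 (a :: s))
    (ht : DGeo 2 (b :: t)) (he : dev 2 (a :: s) = dev 2 (b :: t)) (hab : a.1 ≠ b.1) :
    ∃ r : Word Bool, dev 2 s = dev 2 (b :: r) ∧ dev 2 t = dev 2 (a :: r) ∧
      r.length + 1 = s.length := by
  have l1 := dgeo_two_length hs
  have l2 := dgeo_two_length ht
  have l3 := dgeo_two_length (IsGeodesic.tail hs)
  have l4 := dgeo_two_length (IsGeodesic.tail ht)
  rw [← he] at l2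
  have e1 := expSum_cons true a s
  have e2 := expSum_cons false a s
  have e3 := expSum_cons true b t
  have e4 := expSum_cons false b t
  rw [← he] at e3 e4
  obtain ⟨r, h1, h2, h3⟩ := exists_word_expSum
    ((expSum true (dev 2 s)).toAdd - letterExp true b)
    ((expSum false (dev 2 s)).toAdd - letterExp false b)
  refine ⟨r, expSum_ext fun c => ?_, expSum_ext fun c => ?_, ?_⟩
  · rw [expSum_cons]; cases c <;> omega
  · rw [expSum_cons]; cases c <;> omega
  · rw [h3]
    simp only [List.length_cons] at l1 l2
    rcases a with ⟨_ | _, _ | _⟩ <;> rcases b with ⟨_ | _, _ | _⟩ <;> simp [letterExp] at * <;>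
      omega

end Commuting

section Rewriting

variable {X : Type*}

/-- Interpretation of a letter of a dihedral group as one of two given generators. -/
def plugLetter (x y : X) (a : Bool × Bool) : X × Bool := (if a.1 then x else y, a.2)

/-- Substitution of two given generators in a word of a dihedral group. -/
def plug (x y : X) (s : Word Bool) : Word X := s.map (plugLetter x y)

@[simp] theorem plug_nil (x y : X) : plug x y [] = [] := rfl

@[simp] theorem plug_cons (x y : X) (a : Bool × Bool) (s : Word Bool) :
    plug x y (a :: s) = plugLetter x y a :: plug x y s := rfl

@[simp] theorem plug_append (x y : X) (s t : Word Bool) :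
    plug x y (s ++ t) = plug x y s ++ plug x y t := List.map_append

@[simp] theorem plug_length (x y : X) (s : Word Bool) : (plug x y s).length = s.length :=
  List.length_map _

theorem plug_swapWord (x y : X) (s : Word Bool) : plug x y (swapWord s) = plug y x s := by
  induction s with
  | nil => rfl
  | cons a s ih =>
    have : swapWord (a :: s) = (!a.1, a.2) :: swapWord s := rfl
    rw [this, plug_cons, ih, plug_cons]
    rcases a with ⟨_ | _, _⟩ <;> rfl

@[simp] theorem flipSign_plugLetter (x y : X) (a : Bool × Bool) :
    flipSign (plugLetter x y a) = plugLetter x y (flipSign a) := rfl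

theorem plugLetter_injective {x y : X} (hxy : x ≠ y) {a b : Bool × Bool}
    (h : plugLetter x y a = plugLetter x y b) : a = b := by
  rcases a with ⟨_ | _, _⟩ <;> rcases b with ⟨_ | _, _⟩ <;>
    simp [plugLetter, hxy, hxy.symm] at h ⊢ <;> exact h

theorem plugLetter_true (α : X × Bool) (y : X) : plugLetter α.1 y (true, α.2) = α := rfl

theorem plugLetter_false (x : X) (β : X × Bool) : plugLetter x β.1 (false, β.2) = β := rfl

/-- Two geodesic words of a dihedral group representing the same element, with given first
letters. -/
structure DihPair (k : ℕ) (a : Bool × Bool) (s : Word Bool) (b : Bool × Bool) (t : Word Bool) :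
    Prop where
  left : DGeo k (a :: s)
  right : DGeo k (b :: t)
  eq : dev k (a :: s) = dev k (b :: t)

theorem DihPair.symm {k : ℕ} {a b : Bool × Bool} {s t : Word Bool} (h : DihPair k a s b t) :
    DihPair k b t a s := ⟨h.right, h.left, h.eq.symm⟩

theorem DihPair.swap {k : ℕ} {a b : Bool × Bool} {s t : Word Bool} (h : DihPair k a s b t) :
    DihPair k (!a.1, a.2) (swapWord s) (!b.1, b.2) (swapWord t) :=
  ⟨h.left.swapWord, h.right.swapWord, dev_swapWord h.eq⟩

/-- Labellings allowed here: symmetric, with every finite label equal to two or at least four. -/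
structure GoodLabel (m : X → X → ℕ∞) : Prop where
  symm : ∀ x y, m x y = m y x
  two_or_four : ∀ x y (k : ℕ), x ≠ y → m x y = k → k = 2 ∨ 4 ≤ k

theorem GoodLabel.two_le {m : X → X → ℕ∞} (hm : GoodLabel m) {x y : X} {k : ℕ} (hxy : x ≠ y)
    (hk : m x y = k) : 2 ≤ k := by
  rcases hm.two_or_four x y k hxy hk with h | h <;> omega

/-- The equivalence of words obtained by replacing dihedral geodesics at the front. -/
inductive Eqv (m : X → X → ℕ∞) : Word X → Word X → Prop
  | nil : Eqv m [] []
  | cons {α : X × Bool} {u v : Word X} : Eqv m u v → Eqv m (α :: u) (α :: v)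
  | dih {α β : X × Bool} {k : ℕ} {s t : Word Bool} {u v w : Word X} : α.1 ≠ β.1 →
      m α.1 β.1 = k → DihPair k (true, α.2) s (false, β.2) t →
      Eqv m u (plug α.1 β.1 s ++ w) → Eqv m v (plug α.1 β.1 t ++ w) → Eqv m (α :: u) (β :: v)

variable {m : X → X → ℕ∞}

theorem Eqv.refl (u : Word X) : Eqv m u u := by
  induction u with
  | nil => exact .nil
  | cons a u ih => exact ih.cons

theorem Eqv.length_eq {u v : Word X} (h : Eqv m u v) : u.length = v.length := by
  induction h with
  | nil => rfl
  | cons _ ih => simp [ih]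
  | dih _ _ hp _ _ ih1 ih2 =>
    have := IsGeodesic.length_eq hp.left hp.right hp.eq
    simp at this ih1 ih2
    simp [ih1, ih2, this]

theorem Eqv.append_left (p : Word X) {u v : Word X} (h : Eqv m u v) : Eqv m (p ++ u) (p ++ v) := by
  induction p with
  | nil => exact h
  | cons a p ih => exact ih.cons

theorem Eqv.symm (hm : GoodLabel m) {u v : Word X} (h : Eqv m u v) : Eqv m v u := by
  induction h with
  | nil => exact .nil
  | cons _ ih => exact ih.cons
  | @dih _ _ _ _ _ _ _ w hne hk hp h1 h2 _ _ =>
    refine .dih (w := w) hne.symm ((hm.symm _ _).trans hk) hp.symm.swap ?_ ?_ <;>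
      rw [plug_swapWord] <;> assumption

theorem Eqv.dih_pair (hm : GoodLabel m) {x y : X} {k : ℕ} (hxy : x ≠ y) (hk : m x y = k)
    {a b : Bool × Bool} {s t : Word Bool} {u v w : Word X} (hab : a.1 ≠ b.1)
    (hp : DihPair k a s b t) (hu : Eqv m u (plug x y s ++ w)) (hv : Eqv m v (plug x y t ++ w)) :
    Eqv m (plugLetter x y a :: u) (plugLetter x y b :: v) := by
  rcases a with ⟨_ | _, e⟩ <;> rcases b with ⟨_ | _, f⟩
  · exact absurd rfl hab
  · exact (Eqv.dih (m := m) (α := (x, f)) (β := (y, e)) hxy hk hp.symm hv hu).symm hm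
  · exact .dih (α := (x, e)) (β := (y, f)) hxy hk hp hu hv
  · exact absurd rfl hab

theorem Eqv.inv {α β : X × Bool} {u v : Word X} (h : Eqv m (α :: u) (β :: v)) :
    (α = β ∧ Eqv m u v) ∨ (α.1 ≠ β.1 ∧ ∃ (k : ℕ) (s t : Word Bool) (w : Word X), m α.1 β.1 = k ∧
      DihPair k (true, α.2) s (false, β.2) t ∧
      Eqv m u (plug α.1 β.1 s ++ w) ∧ Eqv m v (plug α.1 β.1 t ++ w)) := by
  cases h with
  | cons h => exact .inl ⟨rfl, h⟩
  | dih hne hk hp h1 h2 => exact .inr ⟨hne, _, _, _, _, hk, hp, h1, h2⟩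

theorem Eqv.tail {α : X × Bool} {u v : Word X} (h : Eqv m (α :: u) (α :: v)) : Eqv m u v := by
  rcases h.inv with h | h
  · exact h.2
  · exact absurd rfl h.1

theorem Eqv.inv_pair (hm : GoodLabel m) {x y : X} {k : ℕ} (hxy : x ≠ y) (hk : m x y = k)
    {a b : Bool × Bool} {u v : Word X}
    (h : Eqv m (plugLetter x y a :: u) (plugLetter x y b :: v)) :
    (a = b ∧ Eqv m u v) ∨ (a.1 ≠ b.1 ∧ ∃ (s t : Word Bool) (w : Word X),
      DihPair k a s b t ∧ Eqv m u (plug x y s ++ w) ∧ Eqv m v (plug x y t ++ w)) := by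
  rcases h.inv with ⟨h1, h2⟩ | ⟨h1, k', s, t, w, h2, h3, h4, h5⟩
  · exact .inl ⟨plugLetter_injective hxy h1, h2⟩
  · right
    rcases a with ⟨_ | _, e⟩ <;> rcases b with ⟨_ | _, f⟩ <;> simp [plugLetter] at h1 h2 h3 h4 h5
    · rw [hm.symm, hk] at h2
      obtain rfl : k = k' := by exact_mod_cast h2
      exact ⟨by simp, swapWord s, swapWord t, w, h3.swap, by rwa [plug_swapWord],
        by rwa [plug_swapWord]⟩
    · rw [hk] at h2
      obtain rfl : k = k' := by exact_mod_cast h2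
      exact ⟨by simp, s, t, w, h3, h4, h5⟩

theorem Eqv.of_dev_eq (hm : GoodLabel m) {x y : X} {k : ℕ} (hxy : x ≠ y) (hk : m x y = k)
    {s t : Word Bool} (hs : DGeo k s) (ht : DGeo k t) (h : dev k s = dev k t) (w : Word X) :
    Eqv m (plug x y s ++ w) (plug x y t ++ w) := by
  induction s generalizing t with
  | nil =>
    have := IsGeodesic.length_eq hs ht h
    rw [List.length_nil] at this
    rw [List.length_eq_zero_iff.1 this.symm]
    exact .refl _
  | cons a s ih =>
    rcases t with _ | ⟨b, t⟩
    · simpa using IsGeodesic.length_eq hs ht h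
    · by_cases hab : a = b
      · subst hab
        exact (ih (IsGeodesic.tail hs) (IsGeodesic.tail ht) (by simpa using h)).cons
      · by_cases hab' : a.1 = b.1
        · have : b = flipSign a := by
            rcases a with ⟨a, _ | _⟩ <;> rcases b with ⟨b, _ | _⟩ <;>
              simp [flipSign] at hab hab' ⊢ <;> simp_all
          subst this
          exact absurd h (dev_ne_of_geo_flip (hm.two_le hxy hk) hs ht)
        · exact .dih_pair hm hxy hk hab' ⟨hs, ht, h⟩ (.refl _) (.refl _)

/-- Words in which no cancellation is possible up to equivalence. -/
def Irr (m : X → X → ℕ∞) : Word X → Prop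
  | [] => True
  | α :: u => Irr m u ∧ ∀ v, ¬ Eqv m u (flipSign α :: v)

theorem Irr.of_append {p u : Word X} (h : Irr m (p ++ u)) : Irr m u := by
  induction p with
  | nil => exact h
  | cons a p ih => exact ih h.1

theorem Irr.dgeo (hm : GoodLabel m) {x y : X} {k : ℕ} (hxy : x ≠ y) (hk : m x y = k)
    {s : Word Bool} {w : Word X} (h : Irr m (plug x y s ++ w)) : DGeo k s := by
  induction s with
  | nil => intro v _; simp
  | cons a s ih =>
    have hs := ih h.1
    by_contra ha
    obtain ⟨t, h1, h2, _⟩ := exists_strip hs ha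
    exact h.2 _ (Eqv.of_dev_eq hm hxy hk hs h1 h2 w)

/-- The word is equivalent to one starting with the generator `x` or its inverse. -/
def HasHead (m : X → X → ℕ∞) (x : X) (w : Word X) : Prop := ∃ e u, Eqv m w ((x, e) :: u)

/-- The basic properties of equivalence, for words of bounded length. -/
structure GoodUpTo (m : X → X → ℕ∞) (n : ℕ) : Prop where
  irr : ∀ {u v : Word X}, Irr m u → u.length ≤ n → Eqv m u v → Irr m v
  trans' : ∀ {u v t : Word X}, Irr m v → v.length ≤ n → Eqv m v u → Eqv m v t → Eqv m u t

variable {n : ℕ}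

theorem GoodUpTo.trans (G : GoodUpTo m n) (hm : GoodLabel m) {u v t : Word X} (hu : Irr m u)
    (hl : u.length ≤ n) (h1 : Eqv m u v) (h2 : Eqv m v t) : Eqv m u t :=
  G.trans' (G.irr hu hl h1) (h1.length_eq ▸ hl) (h1.symm hm) h2

theorem GoodUpTo.exists_gate (G : GoodUpTo m n) (hm : GoodLabel m) (x y : X) {v : Word X}
    (hv : Irr m v) (hl : v.length ≤ n) :
    ∃ (s : Word Bool) (w : Word X), Eqv m v (plug x y s ++ w) ∧ ¬ HasHead m x w ∧
      ¬ HasHead m y w := by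
  induction hN : v.length using Nat.strong_induction_on generalizing v with
  | _ N ih =>
    subst hN
    have key : ∀ a v', Eqv m v (plugLetter x y a :: v') →
        ∃ (s : Word Bool) (w : Word X), Eqv m v (plug x y s ++ w) ∧ ¬ HasHead m x w ∧
          ¬ HasHead m y w := by
      intro a v' h
      have hlen := h.length_eq
      rw [List.length_cons] at hlen
      obtain ⟨s, w, h1, h2⟩ := ih v'.length (by omega) (G.irr hv hl h).1 (by omega) rfl
      exact ⟨a :: s, w, G.trans hm hv hl h h1.cons, h2⟩
    by_cases hx : HasHead m x v
    · obtain ⟨e, v', h⟩ := hx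
      exact key (true, e) v' h
    · by_cases hy : HasHead m y v
      · obtain ⟨e, v', h⟩ := hy
        exact key (false, e) v' h
      · exact ⟨[], v, .refl _, hx, hy⟩

theorem plugLetter_hasHead {x y : X} {w u : Word X} {a : Bool × Bool}
    (h : Eqv m w (plugLetter x y a :: u)) : HasHead m x w ∨ HasHead m y w := by
  rcases a with ⟨_ | _, e⟩
  · exact .inr ⟨e, u, h⟩
  · exact .inl ⟨e, u, h⟩

theorem GoodUpTo.gate_unique (G : GoodUpTo m n) (hm : GoodLabel m) {x y : X} {k : ℕ} (hxy : x ≠ y)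
    (hk : m x y = k) {s t : Word Bool} {w w' : Word X} (hs : Irr m (plug x y s ++ w))
    (hl : (plug x y s ++ w).length ≤ n) (h : Eqv m (plug x y s ++ w) (plug x y t ++ w'))
    (hx : ¬ HasHead m x w) (hy : ¬ HasHead m y w) (hx' : ¬ HasHead m x w')
    (hy' : ¬ HasHead m y w') : Eqv m w w' ∧ dev k s = dev k t := by
  induction hN : (plug x y s ++ w).length using Nat.strong_induction_on
    generalizing s t w w' with
  | _ N ih =>
    subst hN
    have ht := G.irr hs hl h
    have hlen := h.length_eq
    rcases s with _ | ⟨a, s⟩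
    · rcases t with _ | ⟨b, t⟩
      · exact ⟨h, rfl⟩
      · exact ((plugLetter_hasHead h).elim hx hy).elim
    · rcases t with _ | ⟨b, t⟩
      · exact ((plugLetter_hasHead (h.symm hm)).elim hx' hy').elim
      · have hN : (plug x y (a :: s) ++ w).length = (plug x y s ++ w).length + 1 := rfl
        have hN' : (plug x y (b :: t) ++ w').length = (plug x y t ++ w').length + 1 := rfl
        have hs' : Irr m (plug x y s ++ w) := hs.1
        have ht' : Irr m (plug x y t ++ w') := ht.1
        rcases Eqv.inv_pair hm hxy hk h with ⟨rfl, h1⟩ | ⟨_, P, P', q, hp, h1, h2⟩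
        · obtain ⟨h3, h4⟩ := ih _ (by omega) hs' (by omega) h1 hx hy hx' hy' rfl
          exact ⟨h3, by simp [h4]⟩
        · replace h1 : Eqv m (plug x y s ++ w) (plug x y P ++ q) := h1
          replace h2 : Eqv m (plug x y t ++ w') (plug x y P' ++ q) := h2
          have hlq := h1.length_eq
          rw [List.length_append (as := plug x y P)] at hlq
          obtain ⟨r, q0, h3, hqx, hqy⟩ := G.exists_gate hm x y
            (G.irr hs' (by omega) h1).of_append (by omega)
          have e1 := G.trans hm hs' (by omega) h1 (h3.append_left _)
          have e2 := G.trans hm ht' (by omega) h2 (h3.append_left _)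
          rw [← List.append_assoc, ← plug_append] at e1 e2
          obtain ⟨f1, f2⟩ := ih _ (by omega) hs' (by omega) e1 hx hy hqx hqy rfl
          obtain ⟨g1, g2⟩ := ih _ (by omega) ht' (by omega) e2 hx' hy' hqx hqy rfl
          refine ⟨G.trans hm hs'.of_append ?_ f1 (g1.symm hm), ?_⟩
          · rw [List.length_append (as := plug x y s)] at hN
            omega
          · have := hp.eq
            simp only [evalWord_cons, evalWord_append] at this f2 g2 ⊢
            change _ * dev k s = _ * dev k t
            rw [f2, g2, ← mul_assoc, this, mul_assoc]

theorem GoodUpTo.irr_plug_append (G : GoodUpTo m n) (hm : GoodLabel m) {x y : X} {k : ℕ}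
    (hxy : x ≠ y) (hk : m x y = k) {r : Word Bool} {w : Word X} (hw : Irr m w) (hr : DGeo k r)
    (hl : (plug x y r ++ w).length ≤ n + 1) (hx : ¬ HasHead m x w) (hy : ¬ HasHead m y w) :
    Irr m (plug x y r ++ w) := by
  induction r with
  | nil => exact hw
  | cons a r ih =>
    have hN : (plug x y (a :: r) ++ w).length = (plug x y r ++ w).length + 1 := rfl
    have hi := ih (IsGeodesic.tail hr) (by omega)
    refine ⟨hi, fun v hv => ?_⟩
    have hlv := hv.length_eq
    rw [List.length_cons] at hlv
    replace hlv : (plug x y r ++ w).length = v.length + 1 := hlv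
    replace hv : Eqv m (plug x y r ++ w) (plugLetter x y (flipSign a) :: v) := hv
    have hiv := (G.irr hi (by omega) hv).1
    obtain ⟨t, v0, h1, h2, h3⟩ := G.exists_gate hm x y hiv (by omega)
    have h4 : Eqv m (plug x y r ++ w) (plug x y (flipSign a :: t) ++ v0) :=
      G.trans hm hi (by omega) hv h1.cons
    obtain ⟨h5, h6⟩ := G.gate_unique hm hxy hk hi (by omega) h4 hx hy h2 h3
    have h7 := hr t (by
      rw [evalWord_cons]
      change _ = _ * dev k r
      rw [h6]; simp)
    have h8 := h4.length_eq
    have h9 := h5.length_eq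
    simp at h7 h8 h9
    omega

end Rewriting

section Irreducible

variable {X : Type*} {m : X → X → ℕ∞} {n : ℕ}

theorem GoodUpTo.irr_cons (G : GoodUpTo m n) (hm : GoodLabel m) {α : X × Bool} {u v : Word X}
    (hu : Irr m (α :: u)) (hl : u.length ≤ n) (h : Eqv m u v) : Irr m (α :: v) :=
  ⟨G.irr hu.1 hl h, fun w hw => hu.2 w (G.trans hm hu.1 hl h hw)⟩

theorem GoodUpTo.irr_succ (G : GoodUpTo m n) (hm : GoodLabel m) {u v : Word X} (hu : Irr m u)
    (hl : u.length ≤ n + 1) (h : Eqv m u v) : Irr m v := by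
  have hlen := h.length_eq
  cases h with
  | nil => exact hu
  | cons h => exact G.irr_cons hm hu (by simpa using hl) h
  | @dih α β k P P' u v q hne hk hp h1 h2 =>
    simp only [List.length_cons] at hl hlen
    have hl1 := h1.length_eq
    have hl2 := h2.length_eq
    rw [List.length_append, plug_length] at hl1 hl2
    obtain ⟨r, w, h3, hx, hy⟩ := G.exists_gate hm α.1 β.1
      (G.irr hu.1 (by omega) h1).of_append (by omega)
    have hl3 := h3.length_eq
    rw [List.length_append, plug_length] at hl3
    have e1 := G.trans hm hu.1 (by omega) h1 (h3.append_left _)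
    rw [← List.append_assoc, ← plug_append] at e1
    have i1 : Irr m (plug α.1 β.1 ((true, α.2) :: (P ++ r)) ++ w) :=
      G.irr_cons hm hu (by omega) e1
    have d1 := i1.dgeo hm hne hk
    have d2 : DGeo k ((false, β.2) :: (P' ++ r)) := by
      refine IsGeodesic.of_eq d1 ?_ ?_
      · rw [← List.cons_append, ← List.cons_append, evalWord_append, evalWord_append]
        exact congrArg (· * _) hp.eq.symm
      · simp only [List.length_cons, List.length_append]
        omega
    have i2 : Irr m (plug α.1 β.1 (P ++ r) ++ w) := i1.1
    have i3 := G.irr_plug_append hm hne hk i2.of_append d2 (by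
      simp only [List.length_append, plug_length, List.length_cons]; omega) hx hy
    have e2 := (h3.append_left (plug α.1 β.1 P')).symm hm
    rw [← List.append_assoc, ← plug_append] at e2
    have hl4 := e2.length_eq
    simp only [List.length_append, plug_length] at hl4
    have i4 : Irr m (β :: (plug α.1 β.1 P' ++ q)) := G.irr_cons hm i3 (by
      change (plug α.1 β.1 (P' ++ r) ++ w).length ≤ n
      simp only [List.length_append, plug_length]; omega) e2
    exact G.irr_cons hm i4 (by simp only [List.length_append, plug_length]; omega) (h2.symm hm)

theorem dgeo_pair {M : ℕ} (hM : 2 ≤ M) {a b : Bool × Bool} (hab : a.1 ≠ b.1) :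
    DGeo M [a, b] := by
  refine dgeo_of_syl_le hM ?_ ?_ ?_
  · refine List.isChain_pair.2 fun h => hab ?_
    rw [h, flipSign_fst]
  · simp [syl, chg]; omega
  · simp only [syl, chg]; split_ifs <;> omega

theorem commute_letterVal {a b : Bool × Bool} (hab : a.1 ≠ b.1) :
    Commute (letterVal (dgen 2) a) (letterVal (dgen 2) b) := by
  have h : Commute (dgen 2 a.1) (dgen 2 b.1) := by
    have := dgen_two_commute a.1
    rwa [show (!a.1) = b.1 by rcases a with ⟨_ | _, _⟩ <;> rcases b with ⟨_ | _, _⟩ <;> simp_all]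
      at this
  unfold letterVal
  split_ifs <;> simp [h]

theorem Eqv.commute {α β : X × Bool} (hne : α.1 ≠ β.1) (h2 : m α.1 β.1 = 2) {u v w : Word X}
    (hu : Eqv m u (β :: w)) (hv : Eqv m v (α :: w)) : Eqv m (α :: u) (β :: v) := by
  refine .dih (k := 2) (s := [(false, β.2)]) (t := [(true, α.2)]) (w := w) hne (by simpa using h2)
    ⟨dgeo_pair le_rfl (by simp), dgeo_pair le_rfl (by simp), ?_⟩ hu hv
  have := commute_letterVal (a := (true, α.2)) (b := (false, β.2)) (by simp)
  simp only [evalWord_cons, evalWord_nil, mul_one]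
  exact this.eq

theorem GoodUpTo.exists_of_commute (G : GoodUpTo m n) (hm : GoodLabel m) {α β : X × Bool}
    (hne : α.1 ≠ β.1) (h2 : m α.1 β.1 = 2) {u v : Word X} (hu : Irr m (α :: u))
    (hl : u.length ≤ n) (h : Eqv m (α :: u) (β :: v)) :
    ∃ w, Eqv m u (β :: w) ∧ Eqv m v (α :: w) := by
  have hv := G.irr_succ hm hu (by simpa using hl) h
  have hlen := h.length_eq
  simp only [List.length_cons] at hlen
  rcases h.inv with ⟨rfl, _⟩ | ⟨_, k, P, P', q, hk, hp, h3, h4⟩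
  · exact absurd rfl hne
  · obtain rfl : k = 2 := by
      rw [h2] at hk
      exact_mod_cast hk.symm
    obtain ⟨r, e1, e2, e3⟩ := exists_common_tail hp.left hp.right hp.eq (by simp)
    have e4 := IsGeodesic.length_eq hp.left hp.right hp.eq
    simp only [List.length_cons] at e4
    have d1 : DGeo 2 P := IsGeodesic.tail hp.left
    have d2 : DGeo 2 P' := IsGeodesic.tail hp.right
    refine ⟨plug α.1 β.1 r ++ q, G.trans hm hu.1 hl h3 ?_, G.trans hm hv.1 (by omega) h4 ?_⟩
    · exact Eqv.of_dev_eq hm hne hk d1 (IsGeodesic.of_eq d1 e1.symm (by simp; omega)) e1 q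
    · exact Eqv.of_dev_eq hm hne hk d2 (IsGeodesic.of_eq d2 e2.symm (by simp; omega)) e2 q

end Irreducible

section Syllables

theorem chg_swapWord (c : Bool) (s : Word Bool) : chg (!c) (swapWord s) = chg c s := by
  induction s generalizing c with
  | nil => rfl
  | cons a s ih =>
    have : swapWord (a :: s) = (!a.1, a.2) :: swapWord s := rfl
    rw [this, chg, chg, ih]
    simp

@[simp] theorem syl_swapWord (s : Word Bool) : syl (swapWord s) = syl s := by
  rcases s with _ | ⟨a, s⟩
  · rfl
  · exact congrArg (1 + ·) (chg_swapWord a.1 s)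

variable {X : Type*} {m : X → X → ℕ∞} {n : ℕ}

/-- The word is equivalent to one with a prefix in `x` and `y` having at least `j` syllables. -/
def SylAt (m : X → X → ℕ∞) (j : ℕ) (x y : X) (v : Word X) : Prop :=
  ∃ s w, Eqv m v (plug x y s ++ w) ∧ j ≤ syl s

/-- The word is equivalent to one with a prefix in `x` and `y` that adds at least `j` syllables to
a letter `x` preceding it. -/
def ChgAt (m : X → X → ℕ∞) (j : ℕ) (x y : X) (v : Word X) : Prop :=
  ∃ s w, Eqv m v (plug x y s ++ w) ∧ j ≤ chg true s

theorem SylAt.swap {j : ℕ} {x y : X} {v : Word X} : SylAt m j x y v → SylAt m j y x v := by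
  rintro ⟨s, w, h1, h2⟩
  exact ⟨swapWord s, w, by rwa [plug_swapWord], by rwa [syl_swapWord]⟩

theorem SylAt.mono {i j : ℕ} (hij : i ≤ j) {x y : X} {v : Word X} :
    SylAt m j x y v → SylAt m i x y v := by
  rintro ⟨s, w, h1, h2⟩
  exact ⟨s, w, h1, hij.trans h2⟩

theorem SylAt.chgAt {j : ℕ} {x y : X} {v : Word X} (h : SylAt m (j + 1) x y v) :
    ChgAt m j x y v := by
  obtain ⟨s, w, h1, h2⟩ := h
  refine ⟨s, w, h1, ?_⟩
  rcases s with _ | ⟨⟨_ | _, e⟩, s⟩ <;> simp [syl, chg] at h2 ⊢ <;> omega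

theorem ChgAt.sylAt_of_not_hasHead {j : ℕ} {x y : X} {v : Word X} (h : ChgAt m (j + 1) x y v)
    (hx : ¬ HasHead m x v) : HasHead m y v ∧ SylAt m (j + 1) x y v := by
  obtain ⟨s, w, h1, h2⟩ := h
  rcases s with _ | ⟨⟨_ | _, e⟩, s⟩
  · simp [chg] at h2
  · exact ⟨⟨e, _, h1⟩, _, w, h1, by simpa [syl, chg] using h2⟩
  · exact absurd ⟨e, _, h1⟩ hx

theorem GoodUpTo.chgAt_tail (G : GoodUpTo m n) (hm : GoodLabel m) {z y : X} {j : ℕ} {e : Bool}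
    {v v' : Word X} (hzy : z ≠ y) (h2 : m z y ≠ 2) (hj : j ≤ 3) (hv : Irr m v)
    (hl : v.length ≤ n) (h : Eqv m v ((z, e) :: v')) (hT : ChgAt m j z y v) :
    ChgAt m j z y v' := by
  obtain ⟨s, w, h3, h4⟩ := hT
  have h5 := G.trans' hv hl h h3
  rcases s with _ | ⟨⟨_ | _, f⟩, s⟩
  · exact ⟨[], v', .refl _, h4⟩
  · rcases h5.inv with ⟨h6, _⟩ | ⟨_, k, P, P', q, hk, hp, h7, _⟩
    · exact absurd (congrArg Prod.fst h6) hzy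
    · refine ⟨P, q, h7, ?_⟩
      rcases hm.two_or_four z y k hzy hk with rfl | hk4
      · exact (h2 hk).elim
      · have := four_le_syl hk4 hp.left hp.right hp.eq (by simp)
        simp [syl] at this
        omega
  · rcases h5.inv with ⟨_, h6⟩ | ⟨h6, _⟩
    · exact ⟨s, w, h6, by simpa [chg] using h4⟩
    · exact absurd rfl h6

theorem GoodUpTo.hasHead_tail (G : GoodUpTo m n) (hm : GoodLabel m) {x z : X} {e : Bool}
    {v v' : Word X} (hxz : x ≠ z) (h2 : m x z = 2) (hv : Irr m v) (hl : v.length ≤ n)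
    (h : Eqv m v ((z, e) :: v')) (hx : HasHead m x v) : HasHead m x v' := by
  obtain ⟨f, u, hu⟩ := hx
  have hlen := hu.length_eq
  rw [List.length_cons] at hlen
  obtain ⟨w, _, h3⟩ := G.exists_of_commute hm (α := (x, f)) (β := (z, e)) hxz h2
    (G.irr hv hl hu) (by omega) (G.trans' hv hl hu h)
  exact ⟨f, w, h3⟩

theorem GoodUpTo.hasHead_of_tail (G : GoodUpTo m n) (hm : GoodLabel m) {x z : X} {e : Bool}
    {v v' : Word X} (hxz : x ≠ z) (h2 : m x z = 2) (hv : Irr m v) (hl : v.length ≤ n)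
    (h : Eqv m v ((z, e) :: v')) (hx : HasHead m x v') : HasHead m x v := by
  obtain ⟨f, u, hu⟩ := hx
  exact ⟨f, (z, e) :: u, G.trans hm hv hl h
    (.commute (α := (z, e)) (β := (x, f)) hxz.symm ((hm.symm _ _).trans h2) hu (.refl _))⟩

theorem GoodUpTo.sylAt_four (G : GoodUpTo m n) (hm : GoodLabel m) {x y : X} {v : Word X}
    (hxy : x ≠ y) (h2 : m x y ≠ 2) (hv : Irr m v) (hl : v.length ≤ n) (hx : HasHead m x v)
    (hy : HasHead m y v) : SylAt m 4 x y v := by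
  obtain ⟨e, u, hu⟩ := hx
  obtain ⟨f, u', hu'⟩ := hy
  rcases (G.trans' hv hl hu hu').inv with ⟨h3, _⟩ | ⟨_, k, P, P', q, hk, hp, h4, _⟩
  · exact absurd (congrArg Prod.fst h3) hxy
  · refine ⟨(true, e) :: P, q, G.trans hm hv hl hu h4.cons, ?_⟩
    rcases hm.two_or_four x y k hxy hk with rfl | hk4
    · exact absurd (by simpa using hk) h2
    · exact four_le_syl hk4 hp.left hp.right hp.eq (by simp)

theorem map_mk_fst_eq_plug (x y : X) (L : List Bool) :
    L.map (Prod.mk x) = plug x y (L.map (Prod.mk true)) := by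
  simp [plug, plugLetter, Function.comp_def]

theorem GoodUpTo.exists_strip_all (G : GoodUpTo m n) (hm : GoodLabel m) (z : X)
    (Q : Word X → Prop) (hQ : ∀ v e v', Irr m v → v.length ≤ n → Eqv m v ((z, e) :: v') → Q v →
      Q v') {v : Word X} (hv : Irr m v) (hl : v.length ≤ n) (q : Q v) :
    ∃ (L : List Bool) (v' : Word X), Eqv m v (L.map (Prod.mk z) ++ v') ∧ ¬ HasHead m z v' ∧
      Q v' ∧ Irr m v' ∧ v'.length ≤ v.length ∧ (HasHead m z v → v'.length < v.length) := by
  induction hN : v.length using Nat.strong_induction_on generalizing v with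
  | _ N ih =>
    subst hN
    by_cases hz : HasHead m z v
    · obtain ⟨e, u, hu⟩ := hz
      have hlen := hu.length_eq
      rw [List.length_cons] at hlen
      have hi := (G.irr hv hl hu).1
      obtain ⟨L, v', h1, h2, h3, h4, h5, _⟩ :=
        ih u.length (by omega) hi (by omega) (hQ v e u hv hl hu q) rfl
      exact ⟨e :: L, v', G.trans hm hv hl hu h1.cons, h2, h3, h4, by omega, fun _ => by omega⟩
    · exact ⟨[], v, .refl _, hz, q, hv, le_rfl, fun h => absurd h hz⟩

theorem GoodUpTo.not_sylAt_hasHead (G : GoodUpTo m n) (hm : GoodLabel m) {x y z : X}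
    (hxz : x ≠ z) (hxy : x ≠ y) (hzy : z ≠ y) (h1 : m x z = 2) (h2 : m z y ≠ 2) (h3 : m x y ≠ 2)
    {v : Word X} (hv : Irr m v) (hl : v.length ≤ n) (hT : SylAt m 3 z y v)
    (hH : HasHead m x v) : False := by
  induction hN : v.length using Nat.strong_induction_on generalizing x z v with
  | _ N ih =>
    subst hN
    obtain ⟨_, u, _, hz, ⟨q1, q2⟩, hu, hul, _⟩ := G.exists_strip_all hm z
      (fun v => ChgAt m 2 z y v ∧ HasHead m x v)
      (fun v e v' hv hl h q => ⟨G.chgAt_tail hm hzy h2 (by norm_num) hv hl h q.1,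
        G.hasHead_tail hm hxz h1 hv hl h q.2⟩) hv hl ⟨hT.chgAt, hH⟩
    obtain ⟨q3, q4⟩ := q1.sylAt_of_not_hasHead hz
    have q5 := G.sylAt_four hm hxy h3 hu (hul.trans hl) q2 q3
    obtain ⟨_, t, _, hy, ⟨r1, r2⟩, ht, htl, htl'⟩ := G.exists_strip_all hm y
      (fun v => ChgAt m 3 y x v ∧ ChgAt m 1 y z v)
      (fun v e v' hv hl h q =>
        ⟨G.chgAt_tail hm hxy.symm (by rwa [hm.symm]) (by norm_num) hv hl h q.1,
        G.chgAt_tail hm hzy.symm (by rwa [hm.symm]) (by norm_num) hv hl h q.2⟩)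
      hu (hul.trans hl) ⟨q5.swap.chgAt, q4.swap.chgAt⟩
    exact ih t.length ((htl' q3).trans_le hul) hxz.symm hzy hxy (by rwa [hm.symm]) h3 h2 ht
      (by omega) (r1.sylAt_of_not_hasHead hy).2.swap (r2.sylAt_of_not_hasHead hy).1 rfl

theorem GoodUpTo.exists_commuting_gate (G : GoodUpTo m n) (hm : GoodLabel m) {x y z : X}
    (hxy : x ≠ y) (hxz : x ≠ z) (hyz : y ≠ z) (h1 : m x y = 2) (h2 : m x z ≠ 2) (h3 : m y z ≠ 2)
    {v : Word X} (hv : Irr m v) (hl : v.length ≤ n) (hx : HasHead m x v) (hy : HasHead m y v)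
    (hT : SylAt m 2 z x v) : ∃ (s : Word Bool) (w : Word X), Eqv m v (plug x y s ++ w) ∧
      ¬ HasHead m x w ∧ ¬ HasHead m y w ∧ SylAt m 3 y z w ∧ w.length < v.length := by
  have h1' : m y x = 2 := by rwa [hm.symm]
  obtain ⟨L, u, e1, nx, ⟨q1, q2⟩, hu, _, hul⟩ := G.exists_strip_all hm x
    (fun v => ChgAt m 1 x z v ∧ HasHead m y v)
    (fun v e v' hv hl h q => ⟨G.chgAt_tail hm hxz h2 (by norm_num) hv hl h q.1,
      G.hasHead_tail hm hxy.symm h1' hv hl h q.2⟩) hv hl ⟨hT.swap.chgAt, hy⟩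
  have hul := hul hx
  have q3 := G.sylAt_four hm hyz h3 hu (by omega) q2 (q1.sylAt_of_not_hasHead nx).1
  obtain ⟨L', w, e2, ny, ⟨r1, r2⟩, hw, hwl, _⟩ := G.exists_strip_all hm y
    (fun v => ChgAt m 3 y z v ∧ ¬ HasHead m x v)
    (fun v e v' hv hl h q => ⟨G.chgAt_tail hm hyz h3 (by norm_num) hv hl h q.1,
      fun h' => q.2 (G.hasHead_of_tail hm hxy h1 hv hl h h')⟩) hu (by omega) ⟨q3.chgAt, nx⟩
  have e3 := G.trans hm hv hl e1 (e2.append_left _)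
  rw [map_mk_fst_eq_plug x y, map_mk_fst_eq_plug y x, ← plug_swapWord x y, ← List.append_assoc,
    ← plug_append] at e3
  exact ⟨_, w, e3, r2, ny, (r1.sylAt_of_not_hasHead ny).2, by omega⟩

theorem GoodUpTo.not_sylAt_sylAt (G : GoodUpTo m n) (hm : GoodLabel m) {x y z : X}
    (hxz : x ≠ z) (hxy : x ≠ y) (hzy : z ≠ y) (h1 : m x z ≠ 2) (h2 : m z y ≠ 2)
    {v : Word X} (hv : Irr m v) (hl : v.length ≤ n) (hT : SylAt m 3 x z v)
    (hT' : SylAt m 3 z y v) : False := by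
  induction hN : v.length using Nat.strong_induction_on generalizing x y z v with
  | _ N ih =>
    subst hN
    have h1' : m z x ≠ 2 := by rwa [hm.symm]
    have h2' : m y z ≠ 2 := by rwa [hm.symm]
    obtain ⟨_, u, _, hz, ⟨q1, q2⟩, hu, hul, _⟩ := G.exists_strip_all hm z
      (fun v => ChgAt m 2 z x v ∧ ChgAt m 2 z y v)
      (fun v e v' hv hl h q => ⟨G.chgAt_tail hm hxz.symm h1' (by norm_num) hv hl h q.1,
        G.chgAt_tail hm hzy h2 (by norm_num) hv hl h q.2⟩) hv hl ⟨hT.swap.chgAt, hT'.chgAt⟩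
    obtain ⟨ux, uzx⟩ := q1.sylAt_of_not_hasHead hz
    obtain ⟨uy, uzy⟩ := q2.sylAt_of_not_hasHead hz
    by_cases h3 : m x y = 2
    · obtain ⟨s, w, e1, wx, wy, hT1, hwl⟩ := G.exists_commuting_gate hm hxy hxz hzy.symm h3 h1 h2'
        hu (by omega) ux uy uzx
      obtain ⟨s', w', e2, wy', wx', hT2, hwl'⟩ := G.exists_commuting_gate hm hxy.symm hzy.symm hxz
        (by rwa [hm.symm]) h2' h1 hu (by omega) uy ux uzy
      have i1 := G.irr hu (by omega) e1
      have e3 := G.trans' hu (by omega) e1 e2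
      rw [← plug_swapWord x y] at e3
      obtain ⟨e4, _⟩ := G.gate_unique hm (k := 2) hxy (by simpa using h3) i1
        (by rw [← e1.length_eq]; omega) e3 wx wy wx' wy'
      obtain ⟨p, p', e5, hp⟩ := hT2
      refine ih w.length (by omega) hxz hxy hzy h1 h2 i1.of_append (by omega)
        ⟨p, p', ?_, hp⟩ hT1.swap rfl
      exact G.trans hm i1.of_append (by omega) e4 e5
    · have q3 := G.sylAt_four hm hxy h3 hu (by omega) ux uy
      obtain ⟨_, t, _, tx, ⟨r1, r2⟩, ht, htl, htl'⟩ := G.exists_strip_all hm x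
        (fun v => ChgAt m 3 x y v ∧ ChgAt m 1 x z v)
        (fun v e v' hv hl h q => ⟨G.chgAt_tail hm hxy h3 (by norm_num) hv hl h q.1,
          G.chgAt_tail hm hxz h1 (by norm_num) hv hl h q.2⟩)
        hu (by omega) ⟨q3.chgAt, uzx.swap.chgAt⟩
      obtain ⟨ty, txy⟩ := r1.sylAt_of_not_hasHead tx
      have tz := (r2.sylAt_of_not_hasHead tx).1
      have q4 := G.sylAt_four hm hzy.symm h2' ht (by omega) ty tz
      exact ih t.length ((htl' ux).trans_le hul) hxy hxz hzy.symm h3 h2' ht (by omega) txy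
        (q4.mono (by norm_num)) rfl

end Syllables

section Transitivity

variable {X : Type*} {m : X → X → ℕ∞} {n : ℕ}

/-- The letter `α` commutes with, and is distinct from, every letter of the word `p`. -/
def CommutesWith (m : X → X → ℕ∞) (α : X × Bool) (p : Word X) : Prop :=
  ∀ a ∈ p, α.1 ≠ a.1 ∧ m α.1 a.1 = 2

theorem CommutesWith.plug {α : X × Bool} {x y : X} (hx : α.1 ≠ x) (hy : α.1 ≠ y)
    (hmx : m α.1 x = 2) (hmy : m α.1 y = 2) (s : Word Bool) : CommutesWith m α (plug x y s) := by
  intro a ha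
  obtain ⟨b, _, rfl⟩ := List.mem_map.1 ha
  rcases b with ⟨_ | _, e⟩
  · exact ⟨hy, hmy⟩
  · exact ⟨hx, hmx⟩

theorem GoodUpTo.cons_append_comm (G : GoodUpTo m n) (hm : GoodLabel m) {α : X × Bool}
    {p q : Word X} (hp : CommutesWith m α p) (hi : Irr m (α :: (p ++ q)))
    (hl : (α :: (p ++ q)).length ≤ n) : Eqv m (α :: (p ++ q)) (p ++ α :: q) := by
  induction p with
  | nil => exact .refl _
  | cons a p ih =>
    have ha := hp a (by simp)
    have h : Eqv m (α :: a :: (p ++ q)) (a :: α :: (p ++ q)) :=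
      .commute ha.1 ha.2 (.refl _) (.refl _)
    refine G.trans hm hi hl h (Eqv.cons ?_)
    exact ih (fun b hb => hp b (by simp [hb])) (G.irr hi hl h).1 (by simp at hl ⊢; omega)

theorem GoodUpTo.append_cons_comm (G : GoodUpTo m n) (hm : GoodLabel m) {α : X × Bool}
    {p q : Word X} (hp : CommutesWith m α p) (hi : Irr m (p ++ α :: q))
    (hl : (p ++ α :: q).length ≤ n) : Eqv m (p ++ α :: q) (α :: (p ++ q)) := by
  induction p with
  | nil => exact .refl _
  | cons a p ih =>
    have ha := hp a (by simp)
    have h := (ih (fun b hb => hp b (by simp [hb])) hi.1 (by simp at hl ⊢; omega)).cons (α := a)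
    exact G.trans hm hi hl h
      (.commute ha.1.symm ((hm.symm _ _).trans ha.2) (.refl _) (.refl _))

theorem GoodUpTo.exists_of_append_comm (G : GoodUpTo m n) (hm : GoodLabel m) {α : X × Bool}
    {p q w : Word X} (hp : CommutesWith m α p) (hi : Irr m (p ++ q)) (hl : (p ++ q).length ≤ n)
    (h : Eqv m (p ++ q) (α :: w)) : ∃ q', Eqv m q (α :: q') ∧ Eqv m w (p ++ q') := by
  induction p generalizing w with
  | nil => exact ⟨w, h, .refl _⟩
  | cons a p ih =>
    have ha := hp a (by simp)
    have hlen := h.length_eq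
    replace hi : Irr m (a :: (p ++ q)) := hi
    simp only [List.cons_append, List.length_cons] at hlen hl
    obtain ⟨w', h1, h2⟩ := G.exists_of_commute hm ha.1.symm ((hm.symm _ _).trans ha.2) hi
      (by omega) h
    obtain ⟨q', h3, h4⟩ := ih (fun b hb => hp b (by simp [hb])) hi.1 (by omega) h1
    refine ⟨q', h3, G.trans hm (G.irr hi ?_ h).1 (by omega) h2 h4.cons⟩
    simpa using hl

theorem ChgAt.sylAt {j : ℕ} {x y : X} {v : Word X} (h : ChgAt m j x y v) : SylAt m j x y v := by
  obtain ⟨s, w, h1, h2⟩ := h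
  refine ⟨s, w, h1, h2.trans ?_⟩
  rcases s with _ | ⟨⟨_ | _, e⟩, s⟩ <;> simp [syl, chg]

theorem sylAt_three_of_dihPair (hm : GoodLabel m) {x y : X} {k : ℕ} {e : Bool} {b : Bool × Bool}
    {s t : Word Bool} {v w : Word X} (hxy : x ≠ y) (hk : m x y = k) (h2 : m x y ≠ 2)
    (hp : DihPair k (true, e) s b t) (hb : b.1 = false) (h : Eqv m v (plug x y s ++ w)) :
    SylAt m 3 x y v := by
  refine ChgAt.sylAt ⟨s, w, h, ?_⟩
  rcases hm.two_or_four x y k hxy hk with rfl | hk4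
  · exact (h2 hk).elim
  · have := four_le_syl hk4 hp.left hp.right hp.eq (by simp [hb])
    simp [syl] at this
    omega

theorem GoodUpTo.trans_cons (G : GoodUpTo m n) {β : X × Bool} {v u t : Word X} (hv : Irr m v)
    (hl : v.length ≤ n) (h1 : Eqv m v u) (h2 : Eqv m (β :: v) t) : Eqv m (β :: u) t := by
  cases h2 with
  | cons h2 => exact (G.trans' hv hl h1 h2).cons
  | dih hne hk hp h2 h3 => exact .dih hne hk hp (G.trans' hv hl h1 h2) h3

theorem GoodUpTo.trans_of_fst_eq (G : GoodUpTo m n) (hm : GoodLabel m) {β : X × Bool} {x : X}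
    {e f : Bool} {v u t : Word X} (hβ : β.1 ≠ x) (hv : Irr m (β :: v)) (hl : v.length ≤ n)
    (h1 : Eqv m (β :: v) ((x, e) :: u)) (h2 : Eqv m (β :: v) ((x, f) :: t)) :
    Eqv m ((x, e) :: u) ((x, f) :: t) := by
  have hlv : (β :: v).length ≤ n + 1 := by simpa using hl
  have key : ∀ {k : ℕ} {e : Bool} {u : Word X}, m β.1 x = k → Eqv m (β :: v) ((x, e) :: u) →
      ∃ (s s' : Word Bool) (w : Word X), DihPair k (true, β.2) s (false, e) s' ∧
        Eqv m v (plug β.1 x s ++ w) ∧ Eqv m u (plug β.1 x s' ++ w) ∧ ¬ HasHead m β.1 w ∧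
          ¬ HasHead m x w := by
    intro k e u hk h
    have hi := G.irr_succ hm hv hlv h
    have hlen := h.length_eq
    simp only [List.length_cons] at hlen
    rcases h.inv with ⟨rfl, _⟩ | ⟨_, k', P, P', q, hk', hp, h3, h4⟩
    · exact absurd rfl hβ
    · obtain rfl : k = k' := by
        have := hk.symm.trans hk'
        exact_mod_cast this
      have hlq := h3.length_eq
      rw [List.length_append] at hlq
      obtain ⟨r, w, h5, h6, h7⟩ := G.exists_gate hm β.1 x (G.irr hv.1 hl h3).of_append (by omega)
      have e1 := G.trans hm hv.1 hl h3 (h5.append_left _)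
      have e2 := G.trans hm hi.1 (by omega) h4 (h5.append_left _)
      rw [← List.append_assoc, ← plug_append] at e1 e2
      refine ⟨P ++ r, P' ++ r, w, ⟨?_, ?_, ?_⟩, e1, e2, h6, h7⟩
      · exact (show Irr m (plug β.1 x ((true, β.2) :: (P ++ r)) ++ w) from
          G.irr_cons hm hv hl e1).dgeo hm hβ hk
      · exact (show Irr m (plug β.1 x ((false, e) :: (P' ++ r)) ++ w) from
          G.irr_cons hm hi (by omega) e2).dgeo hm hβ hk
      · rw [← List.cons_append, ← List.cons_append, dev, dev, evalWord_append, evalWord_append]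
        exact congrArg (· * _) hp.eq
  obtain ⟨k, hk⟩ : ∃ k : ℕ, m β.1 x = k := by
    rcases h1.inv with ⟨rfl, _⟩ | ⟨_, k, _, _, _, hk, _⟩
    · exact absurd rfl hβ
    · exact ⟨k, hk⟩
  obtain ⟨s1, s1', w1, p1, a1, b1, c1, d1⟩ := key hk h1
  obtain ⟨s2, s2', w2, p2, a2, b2, c2, d2⟩ := key hk h2
  have hlen1 := h1.length_eq
  have hlen2 := h2.length_eq
  simp only [List.length_cons] at hlen1 hlen2
  obtain ⟨hw, hd⟩ := G.gate_unique hm hβ hk (G.irr hv.1 hl a1) (a1.length_eq ▸ hl)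
    (G.trans' hv.1 hl a1 a2) c1 d1 c2 d2
  have heq : dev k ((false, e) :: s1') = dev k ((false, f) :: s2') := by
    rw [← p1.eq, ← p2.eq, dev, evalWord_cons, dev, evalWord_cons]
    exact congrArg (_ * ·) hd
  rcases (Eqv.of_dev_eq hm hβ hk p1.right p2.right heq w1).inv with ⟨h3, h4⟩ | ⟨h3, _⟩
  · obtain rfl : e = f := congrArg Prod.snd h3
    have i1 := (G.irr_succ hm hv hlv h1).1
    refine Eqv.cons (G.trans hm i1 (by omega) b1 ?_)
    refine G.trans hm (G.irr i1 (by omega) b1) (b1.length_eq ▸ by omega) h4 ?_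
    exact G.trans' (G.irr (G.irr_succ hm hv hlv h2).1 (by omega) b2) (b2.length_eq ▸ by omega)
      ((hw.symm hm).append_left _) (b2.symm hm)
  · exact absurd rfl h3

theorem GoodUpTo.trans_of_commute (G : GoodUpTo m n) (hm : GoodLabel m) {α β γ : X × Bool}
    {u v t : Word X} (hβα : β.1 ≠ α.1) (hβγ : β.1 ≠ γ.1) (hαγ : α.1 ≠ γ.1) (hv : Irr m (β :: v))
    (hl : v.length ≤ n) (h1 : m β.1 α.1 = 2) (h2 : m β.1 γ.1 ≠ 2)
    (hu : Eqv m (β :: v) (α :: u)) (ht : Eqv m (β :: v) (γ :: t)) :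
    Eqv m (α :: u) (γ :: t) := by
  have hlv : (β :: v).length ≤ n + 1 := by simpa using hl
  have iu := (G.irr_succ hm hv hlv hu).1
  have it := (G.irr_succ hm hv hlv ht).1
  have hlu := hu.length_eq
  have hlt := ht.length_eq
  simp only [List.length_cons] at hlu hlt
  obtain ⟨w, e1, e2⟩ := G.exists_of_commute hm hβα h1 hv hl hu
  rcases ht.inv with ⟨rfl, _⟩ | ⟨_, k, P, P', q, hk, hp, h3, h4⟩
  · exact absurd rfl hβγ
  · have h1' : m α.1 β.1 = 2 := by rwa [hm.symm]
    by_cases h5 : m α.1 γ.1 = 2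
    · obtain ⟨q', f1, f2⟩ := G.exists_of_append_comm hm
        (CommutesWith.plug hβα.symm hαγ h1' h5 P) (G.irr hv.1 hl h3) (h3.length_eq ▸ hl)
        (G.trans' hv.1 hl h3 e1)
      refine .commute hαγ h5 (w := plug β.1 γ.1 P' ++ q') ?_ ?_
      · refine G.trans hm iu (by omega) (G.trans hm iu (by omega) e2 f2.cons) ?_
        exact .dih hβγ hk hp (.refl _) (.refl _)
      · have g := G.trans hm it (by omega) h4 (f1.append_left _)
        exact G.trans hm it (by omega) g (G.append_cons_comm hm
          (CommutesWith.plug hβα.symm hαγ h1' h5 P') (G.irr it (by omega) g)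
          (g.length_eq ▸ by omega))
    · exact (G.not_sylAt_hasHead hm hβα.symm hαγ hβγ h1' h2 h5 hv.1 hl
        (sylAt_three_of_dihPair hm hβγ hk h2 hp rfl h3) ⟨α.2, w, e1⟩).elim

theorem GoodUpTo.trans_of_commute_commute (G : GoodUpTo m n) (hm : GoodLabel m)
    {α β γ : X × Bool} {u v t : Word X} (hβα : β.1 ≠ α.1) (hβγ : β.1 ≠ γ.1) (hαγ : α.1 ≠ γ.1)
    (hv : Irr m (β :: v)) (hl : v.length ≤ n) (h1 : m β.1 α.1 = 2) (h2 : m β.1 γ.1 = 2)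
    (hu : Eqv m (β :: v) (α :: u)) (ht : Eqv m (β :: v) (γ :: t)) :
    Eqv m (α :: u) (γ :: t) := by
  have hlv : (β :: v).length ≤ n + 1 := by simpa using hl
  have iu := (G.irr_succ hm hv hlv hu).1
  have it := (G.irr_succ hm hv hlv ht).1
  have hlu := hu.length_eq
  have hlt := ht.length_eq
  simp only [List.length_cons] at hlu hlt
  obtain ⟨w1, a1, b1⟩ := G.exists_of_commute hm hβα h1 hv hl hu
  obtain ⟨w2, a2, b2⟩ := G.exists_of_commute hm hβγ h2 hv hl ht
  rcases (G.trans' hv.1 hl a1 a2).inv with ⟨rfl, _⟩ | ⟨_, k, P, P', q, hk, hp, h3, h4⟩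
  · exact absurd rfl hαγ
  · have f1 := G.trans hm iu (by omega) b1 h3.cons
    have f2 := G.trans hm it (by omega) b2 h4.cons
    refine .dih (w := β :: q) hαγ hk hp ?_ ?_
    · exact G.trans hm iu (by omega) f1 (G.cons_append_comm hm
        (CommutesWith.plug hβα hβγ h1 h2 P) (G.irr iu (by omega) f1) (f1.length_eq ▸ by omega))
    · exact G.trans hm it (by omega) f2 (G.cons_append_comm hm
        (CommutesWith.plug hβα hβγ h1 h2 P') (G.irr it (by omega) f2) (f2.length_eq ▸ by omega))

theorem GoodUpTo.trans_succ (G : GoodUpTo m n) (hm : GoodLabel m) {u v t : Word X}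
    (hv : Irr m v) (hl : v.length ≤ n + 1) (h1 : Eqv m v u) (h2 : Eqv m v t) : Eqv m u t := by
  rcases v with _ | ⟨β, v⟩
  · cases h1
    exact h2
  have hlv : v.length ≤ n := by simpa using hl
  have hlen1 := h1.length_eq
  have hlen2 := h2.length_eq
  rcases u with _ | ⟨α, u⟩
  · simp at hlen1
  rcases t with _ | ⟨γ, t⟩
  · simp at hlen2
  rcases h1.inv with ⟨rfl, h3⟩ | ⟨hα, k1, P1, P1', q1, hk1, hp1, a1, b1⟩
  · exact G.trans_cons hv.1 hlv h3 h2
  rcases h2.inv with ⟨rfl, h4⟩ | ⟨hγ, k2, P2, P2', q2, hk2, hp2, a2, b2⟩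
  · exact (G.trans_cons hv.1 hlv h4 h1).symm hm
  by_cases hαγ : α.1 = γ.1
  · obtain ⟨x, e⟩ := α
    obtain ⟨y, f⟩ := γ
    obtain rfl : x = y := hαγ
    exact G.trans_of_fst_eq hm hα hv hlv h1 h2
  by_cases c1 : m β.1 α.1 = 2 <;> by_cases c2 : m β.1 γ.1 = 2
  · exact G.trans_of_commute_commute hm hα hγ hαγ hv hlv c1 c2 h1 h2
  · exact G.trans_of_commute hm hα hγ hαγ hv hlv c1 c2 h1 h2
  · exact (G.trans_of_commute hm hγ hα (Ne.symm hαγ) hv hlv c2 c1 h2 h1).symm hm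
  · exact (G.not_sylAt_sylAt hm hα.symm hαγ hγ (by rwa [hm.symm]) c2 hv.1 hlv
      (sylAt_three_of_dihPair hm hα hk1 c1 hp1 rfl a1).swap
      (sylAt_three_of_dihPair hm hγ hk2 c2 hp2 rfl a2)).elim

theorem goodUpTo (hm : GoodLabel m) (n : ℕ) : GoodUpTo m n := by
  induction n with
  | zero =>
    refine ⟨fun {u v} hu hl h => ?_, fun {u v t} hv hl h1 h2 => ?_⟩
    · obtain rfl := List.length_eq_zero_iff.1 (Nat.le_zero.1 hl)
      cases h
      exact hu
    · obtain rfl := List.length_eq_zero_iff.1 (Nat.le_zero.1 hl)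
      cases h1
      exact h2
  | succ n G => exact ⟨G.irr_succ hm, G.trans_succ hm⟩

end Transitivity

section Action

variable {X : Type*} {m : X → X → ℕ∞}

theorem irr_of_eqv (hm : GoodLabel m) {u v : Word X} (hu : Irr m u) (h : Eqv m u v) : Irr m v :=
  (goodUpTo hm u.length).irr hu le_rfl h

theorem eqv_trans (hm : GoodLabel m) {u v t : Word X} (hu : Irr m u) (h1 : Eqv m u v)
    (h2 : Eqv m v t) : Eqv m u t :=
  (goodUpTo hm u.length).trans hm hu le_rfl h1 h2

/-- Equivalence of irreducible words. -/
def irrSetoid (hm : GoodLabel m) : Setoid {w : Word X // Irr m w} where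
  r u v := Eqv m u.1 v.1
  iseqv := ⟨fun u => .refl u.1, fun h => h.symm hm, fun {u _ _} h1 h2 => eqv_trans hm u.2 h1 h2⟩

/-- Equivalence classes of irreducible words. -/
abbrev IrrClass (hm : GoodLabel m) : Type _ := Quotient (irrSetoid hm)

/-- The class of an irreducible word. -/
def irrMk (hm : GoodLabel m) (u : Word X) (hu : Irr m u) : IrrClass hm := Quotient.mk _ ⟨u, hu⟩

theorem irrMk_eq (hm : GoodLabel m) {u v : Word X} {hu : Irr m u} {hv : Irr m v}
    (h : Eqv m u v) : irrMk hm u hu = irrMk hm v hv := Quotient.sound h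

theorem exists_eqv_of_not_irr_cons {α : X × Bool} {u : Word X} (hu : Irr m u)
    (h : ¬ Irr m (α :: u)) : ∃ v, Eqv m u (flipSign α :: v) := by
  by_contra hn
  exact h ⟨hu, fun v hv => hn ⟨v, hv⟩⟩

open Classical in
/-- Left multiplication of an irreducible word by a letter. -/
noncomputable def actWord (hm : GoodLabel m) (α : X × Bool) (u : {w : Word X // Irr m w}) :
    IrrClass hm :=
  if h : Irr m (α :: u.1) then irrMk hm _ h
  else irrMk hm (exists_eqv_of_not_irr_cons u.2 h).choose
    (irr_of_eqv hm u.2 (exists_eqv_of_not_irr_cons u.2 h).choose_spec).1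

theorem actWord_of_irr (hm : GoodLabel m) {α : X × Bool} {u : {w : Word X // Irr m w}}
    (h : Irr m (α :: u.1)) : actWord hm α u = irrMk hm _ h := dif_pos h

theorem actWord_of_eqv (hm : GoodLabel m) {α : X × Bool} {u : {w : Word X // Irr m w}}
    {v : Word X} (h : Eqv m u.1 (flipSign α :: v)) :
    actWord hm α u = irrMk hm v (irr_of_eqv hm u.2 h).1 := by
  have hn : ¬ Irr m (α :: u.1) := fun h' => h'.2 v h
  rw [actWord, dif_neg hn]
  have hs := (exists_eqv_of_not_irr_cons u.2 hn).choose_spec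
  exact irrMk_eq hm (eqv_trans hm (irr_of_eqv hm u.2 hs) (hs.symm hm) h).tail

/-- The action of a letter on classes of irreducible words. -/
noncomputable def act (hm : GoodLabel m) (α : X × Bool) : IrrClass hm → IrrClass hm :=
  Quotient.lift (actWord hm α) fun u v (h : Eqv m u.1 v.1) => by
    by_cases hu : Irr m (α :: u.1)
    · have hv : Irr m (α :: v.1) := irr_of_eqv hm hu h.cons
      rw [actWord_of_irr hm hu, actWord_of_irr hm hv]
      exact irrMk_eq hm h.cons
    · obtain ⟨w, hw⟩ := exists_eqv_of_not_irr_cons u.2 hu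
      rw [actWord_of_eqv hm hw, actWord_of_eqv hm (eqv_trans hm v.2 (h.symm hm) hw)]

theorem act_irrMk_of_irr (hm : GoodLabel m) {α : X × Bool} {u : Word X} (h : Irr m (α :: u)) :
    act hm α (irrMk hm u h.1) = irrMk hm (α :: u) h := actWord_of_irr hm (u := ⟨u, h.1⟩) h

theorem act_irrMk_of_eqv (hm : GoodLabel m) {α : X × Bool} {u v : Word X} (hu : Irr m u)
    (h : Eqv m u (flipSign α :: v)) :
    act hm α (irrMk hm u hu) = irrMk hm v (irr_of_eqv hm hu h).1 :=
  actWord_of_eqv hm (u := ⟨u, hu⟩) h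

theorem act_act_flipSign (hm : GoodLabel m) (α : X × Bool) (p : IrrClass hm) :
    act hm α (act hm (flipSign α) p) = p := by
  induction p using Quotient.inductionOn with
  | h u =>
    obtain ⟨u, hu⟩ := u
    change act hm α (act hm (flipSign α) (irrMk hm u hu)) = irrMk hm u hu
    by_cases h : Irr m (flipSign α :: u)
    · rw [act_irrMk_of_irr hm h, act_irrMk_of_eqv hm h (.refl _)]
    · obtain ⟨v, hv⟩ := exists_eqv_of_not_irr_cons hu h
      rw [act_irrMk_of_eqv hm hu hv]
      rw [flipSign_flipSign] at hv
      rw [act_irrMk_of_irr hm (irr_of_eqv hm hu hv)]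
      exact irrMk_eq hm (hv.symm hm)

/-- The permutation of classes of irreducible words induced by a generator. -/
noncomputable def actPerm (hm : GoodLabel m) (x : X) : Equiv.Perm (IrrClass hm) where
  toFun := act hm (x, true)
  invFun := act hm (x, false)
  left_inv := act_act_flipSign hm (x, false)
  right_inv := act_act_flipSign hm (x, true)

theorem letterVal_actPerm (hm : GoodLabel m) (α : X × Bool) (p : IrrClass hm) :
    letterVal (actPerm hm) α p = act hm α p := by
  rcases α with ⟨x, _ | _⟩ <;> rfl

theorem letterVal_plugLetter {G : Type*} [Group G] (f : X → G) (x y : X) (a : Bool × Bool) :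
    letterVal f (plugLetter x y a) = letterVal (fun b => if b then f x else f y) a := by
  rcases a with ⟨_ | _, _ | _⟩ <;> rfl

theorem evalWord_plug {G : Type*} [Group G] (f : X → G) (x y : X) (s : Word Bool) :
    evalWord f (plug x y s) = evalWord (fun b => if b then f x else f y) s := by
  induction s with
  | nil => rfl
  | cons a s ih => rw [plug_cons, evalWord_cons, evalWord_cons, ih, letterVal_plugLetter]

theorem exists_dgeo (k : ℕ) (s : Word Bool) : ∃ r, DGeo k r ∧ dev k r = dev k s := by
  classical
  have h : ∃ l, ∃ r, r.length = l ∧ dev k r = dev k s := ⟨_, s, rfl, rfl⟩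
  obtain ⟨r, h1, h2⟩ := Nat.find_spec h
  exact ⟨r, fun v hv => h1.trans_le (Nat.find_min' h ⟨v, rfl, hv.trans h2⟩), h2⟩

theorem irr_plug_append (hm : GoodLabel m) {x y : X} {k : ℕ} (hxy : x ≠ y) (hk : m x y = k)
    {r : Word Bool} {w : Word X} (hw : Irr m w) (hr : DGeo k r) (hx : ¬ HasHead m x w)
    (hy : ¬ HasHead m y w) : Irr m (plug x y r ++ w) :=
  (goodUpTo hm (plug x y r ++ w).length).irr_plug_append hm hxy hk hw hr (Nat.le_succ _) hx hy

theorem evalWord_actPerm_gate (hm : GoodLabel m) {x y : X} {k : ℕ} (hxy : x ≠ y)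
    (hk : m x y = k) {w : Word X} (hw : Irr m w) (hx : ¬ HasHead m x w) (hy : ¬ HasHead m y w)
    {r s : Word Bool} (hr : DGeo k r) (h : dev k r = dev k s) :
    evalWord (actPerm hm) (plug x y s) (irrMk hm w hw) =
      irrMk hm (plug x y r ++ w) (irr_plug_append hm hxy hk hw hr hx hy) := by
  induction s generalizing r with
  | nil =>
    obtain rfl : r = [] := List.length_eq_zero_iff.1 (Nat.le_zero.1 (hr [] h.symm))
    rfl
  | cons a s ih =>
    obtain ⟨t, ht, hts⟩ := exists_dgeo k s
    have hra : dev k r = dev k (a :: t) := by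
      rw [h, dev, dev, evalWord_cons, evalWord_cons]
      exact congrArg (_ * ·) hts.symm
    rw [plug_cons, evalWord_cons, Equiv.Perm.mul_apply, ih ht hts, letterVal_actPerm]
    by_cases ha : DGeo k (a :: t)
    · rw [act_irrMk_of_irr hm (α := plugLetter x y a) (u := plug x y t ++ w)
        (irr_plug_append hm hxy hk hw ha hx hy)]
      exact irrMk_eq hm (Eqv.of_dev_eq hm hxy hk ha hr hra.symm w)
    · obtain ⟨t', h1, h2, _⟩ := exists_strip ht ha
      rw [act_irrMk_of_eqv hm (α := plugLetter x y a) (v := plug x y t' ++ w) _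
        (Eqv.of_dev_eq hm hxy hk ht h1 h2 w)]
      refine irrMk_eq hm (Eqv.of_dev_eq hm hxy hk (IsGeodesic.tail h1) hr ?_ w)
      rw [hra, dev, dev, evalWord_cons]
      change _ = _ * dev k t
      rw [h2]
      simp

/-- The positive alternating word of length `n` starting with the letter `b`. -/
def altWord : ℕ → Bool → Word Bool
  | 0, _ => []
  | n + 1, b => (b, true) :: altWord n (!b)

theorem evalWord_altWord {G : Type*} [Group G] (f : Bool → G) (n : ℕ) (b : Bool) :
    evalWord f (altWord n b) = altMul f n b := by
  induction n generalizing b with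
  | zero => rfl
  | succ n ih => rw [altWord, evalWord_cons, ih, altMul]; rfl

theorem evalWord_actPerm_congr (hm : GoodLabel m) {x y : X} {k : ℕ} (hxy : x ≠ y)
    (hk : m x y = k) {s t : Word Bool} (h : dev k s = dev k t) :
    evalWord (actPerm hm) (plug x y s) = evalWord (actPerm hm) (plug x y t) := by
  ext p
  induction p using Quotient.inductionOn with
  | h u =>
    obtain ⟨u, hu⟩ := u
    change evalWord (actPerm hm) (plug x y s) (irrMk hm u hu) =
      evalWord (actPerm hm) (plug x y t) (irrMk hm u hu)
    obtain ⟨r, w, h1, hx, hy⟩ := (goodUpTo hm u.length).exists_gate hm x y hu le_rfl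
    have hi := irr_of_eqv hm hu h1
    have e : irrMk hm u hu = evalWord (actPerm hm) (plug x y r) (irrMk hm w hi.of_append) := by
      rw [evalWord_actPerm_gate hm hxy hk hi.of_append hx hy (hi.dgeo hm hxy hk) rfl]
      exact irrMk_eq hm h1
    obtain ⟨q, hq1, hq2⟩ := exists_dgeo k (s ++ r)
    rw [e, ← Equiv.Perm.mul_apply, ← Equiv.Perm.mul_apply, ← evalWord_append, ← evalWord_append,
      ← plug_append, ← plug_append, evalWord_actPerm_gate hm hxy hk hi.of_append hx hy hq1 hq2,
      evalWord_actPerm_gate hm hxy hk hi.of_append hx hy hq1 (hq2.trans _)]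
    rw [dev, dev, evalWord_append, evalWord_append]
    exact congrArg (· * _) h

/-- The action of the Artin group on classes of irreducible words. -/
noncomputable def actHom (hm : GoodLabel m) : ArtinGroup m →* Equiv.Perm (IrrClass hm) :=
  PresentedGroup.toGroup (f := actPerm hm) <| lift_artinRels _ fun x y k hxy hk => by
    rw [← evalWord_altWord, ← evalWord_altWord, ← evalWord_plug, ← evalWord_plug]
    refine evalWord_actPerm_congr hm hxy hk ?_
    rw [dev, dev, evalWord_altWord, evalWord_altWord]
    exact (altMul_dgen k false).symm

theorem actHom_evalWord (hm : GoodLabel m) (w : Word X) :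
    actHom hm (evalWord (artinGen m) w) = evalWord (actPerm hm) w := by
  rw [map_evalWord]
  congr 1

/-- The length of a class of irreducible words. -/
def irrLength (hm : GoodLabel m) : IrrClass hm → ℕ :=
  Quotient.lift (fun u => u.1.length) fun _ _ h => Eqv.length_eq h

theorem irrLength_act_le (hm : GoodLabel m) (α : X × Bool) (p : IrrClass hm) :
    irrLength hm (act hm α p) ≤ irrLength hm p + 1 := by
  induction p using Quotient.inductionOn with
  | h u =>
    obtain ⟨u, hu⟩ := u
    change irrLength hm (act hm α (irrMk hm u hu)) ≤ u.length + 1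
    by_cases h : Irr m (α :: u)
    · rw [act_irrMk_of_irr hm h]
      exact le_rfl
    · obtain ⟨v, hv⟩ := exists_eqv_of_not_irr_cons hu h
      rw [act_irrMk_of_eqv hm hu hv]
      have := hv.length_eq
      rw [List.length_cons] at this
      change v.length ≤ _
      omega

theorem irrLength_evalWord_le (hm : GoodLabel m) (w : Word X) :
    irrLength hm (evalWord (actPerm hm) w (irrMk hm [] trivial)) ≤ w.length := by
  induction w with
  | nil => exact le_rfl
  | cons a w ih =>
    rw [evalWord_cons, Equiv.Perm.mul_apply, letterVal_actPerm]
    exact (irrLength_act_le hm _ _).trans (Nat.succ_le_succ ih)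

theorem evalWord_actPerm_nil (hm : GoodLabel m) {u : Word X} (hu : Irr m u) :
    evalWord (actPerm hm) u (irrMk hm [] trivial) = irrMk hm u hu := by
  induction u with
  | nil => rfl
  | cons a u ih =>
    rw [evalWord_cons, Equiv.Perm.mul_apply, ih hu.1, letterVal_actPerm, act_irrMk_of_irr hm hu]

theorem Irr.isGeodesic (hm : GoodLabel m) {u : Word X} (hu : Irr m u) :
    IsGeodesic (artinGen m) u := by
  intro v hv
  have h := irrLength_evalWord_le hm v
  rw [← actHom_evalWord, hv, actHom_evalWord, evalWord_actPerm_nil hm hu] at h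
  exact h

theorem evalWord_plug_congr {x y : X} {k : ℕ} (hxy : x ≠ y) (hk : m x y = k) {s t : Word Bool}
    (h : dev k s = dev k t) :
    evalWord (artinGen m) (plug x y s) = evalWord (artinGen m) (plug x y t) := by
  rw [evalWord_plug, evalWord_plug, ← dihLift_dev _ (altMul_artinGen hxy hk), h, dihLift_dev]

theorem Eqv.evalWord_eq {u v : Word X} (h : Eqv m u v) :
    evalWord (artinGen m) u = evalWord (artinGen m) v := by
  induction h with
  | nil => rfl
  | cons _ ih => rw [evalWord_cons, evalWord_cons, ih]
  | @dih α β k s t u v w hne hk hp _ _ ih1 ih2 =>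
    have := evalWord_plug_congr hne hk hp.eq
    simp only [plug_cons, plugLetter_true, plugLetter_false, evalWord_cons] at this
    rw [evalWord_cons, evalWord_cons, ih1, ih2, evalWord_append, evalWord_append, ← mul_assoc,
      ← mul_assoc, this]

theorem irr_of_isGeodesic {u : Word X} (hu : IsGeodesic (artinGen m) u) : Irr m u := by
  induction u with
  | nil => trivial
  | cons a u ih =>
    refine ⟨ih (IsGeodesic.tail hu), fun v hv => ?_⟩
    have h1 := hu v (by rw [evalWord_cons, hv.evalWord_eq, evalWord_cons]; simp)
    have h2 := hv.length_eq
    simp only [List.length_cons] at h1 h2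
    omega

end Action

section Blocking

variable {X : Type*} {m : X → X → ℕ∞}

theorem blockingPair_of_not_hasHead (hm : GoodLabel m) {u : Word X} {x : X × Bool}
    (H : ∀ w, Irr m (invWord u ++ w) → ¬ HasHead m x.1 (invWord u ++ w)) :
    BlockingPair (artinGen m) u x := by
  intro w hw
  have h1 := irr_of_isGeodesic (isGeodesic_invWord hw)
  rw [invWord_append] at h1
  have h2 : Irr m (flipSign x :: (invWord u ++ invWord w)) := by
    refine ⟨h1, fun v hv => H _ h1 ⟨x.2, v, ?_⟩⟩
    simpa using hv
  have h3 := isGeodesic_invWord (h2.isGeodesic hm)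
  simpa [invWord, Function.comp_def] using h3

theorem sylAt_three_of_hasHead (hm : GoodLabel m) {x y : X} {e : Bool} {v : Word X} (hxy : x ≠ y)
    (h2 : m x y ≠ 2) (hv : Irr m ((x, e) :: v)) (hy : HasHead m y ((x, e) :: v)) :
    SylAt m 3 x y v :=
  have G := goodUpTo hm ((x, e) :: v).length
  (G.chgAt_tail hm hxy h2 le_rfl hv le_rfl (.refl _)
    (G.sylAt_four hm hxy h2 hv le_rfl ⟨e, v, .refl _⟩ hy).chgAt).sylAt

theorem sylAt_three_cons {x y : X} (e f g : Bool) (v : Word X) :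
    SylAt m 3 x y ((x, e) :: (y, f) :: (x, g) :: v) :=
  ⟨[(true, e), (false, f), (true, g)], v, .refl _, by simp [syl, chg]⟩

end Blocking

end ArtinBlocking

open ArtinBlocking

/-- In a 3-free Artin group with pairwise distinct generators `a, b, c` such that
`m a b > 3`, `m b c > 3`, and `m a c = 2`, each of the pairs `(babc, b⁻¹)`, `(cb⁻¹, a⁻¹)`,
`(bcb⁻¹a⁻¹, b⁻¹)`, and `(a⁻¹b⁻¹, c⁻¹)` is a blocking pair. -/
theorem threeFree_blockingPairs {X : Type*} [Fintype X] (m : X → X → ℕ∞)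
    (hsymm : ∀ x y : X, m x y = m y x) (hge2 : ∀ x y : X, x ≠ y → 2 ≤ m x y)
    (h3free : ∀ x y : X, x ≠ y → m x y ≠ 3)
    (a b c : X) (hab : a ≠ b) (hbc : b ≠ c) (hac : a ≠ c)
    (hmab : 3 < m a b) (hmbc : 3 < m b c) (hmac : m a c = 2) :
    BlockingPair (artinGen m) [(b, true), (a, true), (b, true), (c, true)] (b, false) ∧
    BlockingPair (artinGen m) [(c, true), (b, false)] (a, false) ∧
    BlockingPair (artinGen m) [(b, true), (c, true), (b, false), (a, false)] (b, false) ∧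
    BlockingPair (artinGen m) [(a, false), (b, false)] (c, false) := by
  have hm : GoodLabel m := by
    refine ⟨hsymm, fun x y k hxy hk => ?_⟩
    have h2 := hge2 x y hxy
    have h3 := h3free x y hxy
    rw [hk] at h2 h3
    have h2' : 2 ≤ k := by exact_mod_cast h2
    have h3' : k ≠ 3 := by exact_mod_cast h3
    omega
  have hab2 : m a b ≠ 2 := by
    intro h
    rw [h] at hmab
    exact absurd hmab (by decide)
  have hbc2 : m b c ≠ 2 := by
    intro h
    rw [h] at hmbc
    exact absurd hmbc (by decide)
  have hba2 : m b a ≠ 2 := by rwa [hsymm]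
  have hcb2 : m c b ≠ 2 := by rwa [hsymm]
  have hmca : m c a = 2 := by rwa [hsymm]
  refine ⟨blockingPair_of_not_hasHead hm fun w hw hh => ?_,
    blockingPair_of_not_hasHead hm fun w hw hh => ?_,
    blockingPair_of_not_hasHead hm fun w hw hh => ?_,
    blockingPair_of_not_hasHead hm fun w hw hh => ?_⟩
  · exact (goodUpTo hm _).not_sylAt_sylAt hm hab hac hbc hab2 hbc2 hw.1 le_rfl
      (sylAt_three_cons _ _ _ w).swap (sylAt_three_of_hasHead hm hbc.symm hcb2 hw hh).swap
  · exact (goodUpTo hm _).not_sylAt_hasHead hm hac.symm hbc.symm hab hmca hab2 hcb2 hw.1 le_rfl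
      (sylAt_three_of_hasHead hm hab.symm hba2 hw hh).swap ⟨false, w, .refl _⟩
  · exact (goodUpTo hm _).not_sylAt_sylAt hm hab hac hbc hab2 hbc2 hw.1 le_rfl
      (sylAt_three_of_hasHead hm hab hab2 hw hh) (sylAt_three_cons _ _ _ w)
  · exact (goodUpTo hm _).not_sylAt_hasHead hm hac hab hbc.symm hmac hcb2 hab2 hw.1 le_rfl
      (sylAt_three_of_hasHead hm hbc hbc2 hw hh).swap ⟨true, w, .refl _⟩
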